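/- arXiv:math/0211298 — 3 statements merged into one kernel-verified Lean document; each statement's English description precedes it below -/
import Mathlib

section
/- Let κ > ω be a cardinal and let (x_α)_{α<κ} and (y_α)_{α<κ} be subsymmetric κ-sequences in real Banach spaces; put X = closed linear span of {x_α : α < κ} and Y = closed linear span of {y_α : α < κ}. If X and Y are isomorphic, then the families (x_α)_{α<κ} and (y_α)_{α<κ} are equivalent. -/
noncomputable section

universe u v u'

/-- A packaged real Banach space. -/
structure BanachSpace : Type (u + 1) where
  carrier : Type u
  [norm : NormedAddCommGroup carrier]
  [smulR : NormedSpace ℝ carrier]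
  [complete : CompleteSpace carrier]

attribute [instance] BanachSpace.norm BanachSpace.smulR BanachSpace.complete

section Seq

variable {ι : Type v} [LinearOrder ι]

/-- A family `x` indexed by a linear order is *spreading* if the norm of finite linear
combinations over increasing indices does not depend on the choice of increasing indices. -/
def IsSpreading {X : Type u} [SeminormedAddCommGroup X] [NormedSpace ℝ X] (x : ι → X) : Prop :=
  ∀ (n : ℕ) (a : Fin n → ℝ) (i j : Fin n → ι), StrictMono i → StrictMono j →
    ‖∑ k, a k • x (i k)‖ = ‖∑ k, a k • x (j k)‖

/-- A family `x` is *symmetric* if the norm of finite linear combinations over distinct indices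
is invariant under permutations of the coefficients. -/
def IsSymmSeq {X : Type u} [SeminormedAddCommGroup X] [NormedSpace ℝ X] (x : ι → X) : Prop :=
  ∀ (n : ℕ) (a : Fin n → ℝ) (i : Fin n → ι), Function.Injective i →
    ∀ π : Equiv.Perm (Fin n), ‖∑ k, a k • x (i k)‖ = ‖∑ k, a (π k) • x (i k)‖

/-- A family `x` is *1-unconditional* if changing signs of coefficients does not change the
norm of finite linear combinations. -/
def IsUnconditionalSeq {X : Type u} [SeminormedAddCommGroup X] [NormedSpace ℝ X]
    (x : ι → X) : Prop :=
  ∀ (n : ℕ) (a ε : Fin n → ℝ) (i : Fin n → ι), StrictMono i → (∀ k, ε k = 1 ∨ ε k = -1) →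
    ‖∑ k, (ε k * a k) • x (i k)‖ = ‖∑ k, a k • x (i k)‖

/-- A family is *subsymmetric* if it is both spreading and 1-unconditional. -/
def IsSubsymmetric {X : Type u} [SeminormedAddCommGroup X] [NormedSpace ℝ X] (x : ι → X) : Prop :=
  IsSpreading x ∧ IsUnconditionalSeq x

/-- Two families (possibly in different spaces) are *C-equivalent* if equally-indexed finite
linear combinations over increasing indices have norms within the factor `C` of each other. -/
def SeqCEquiv {X : Type u} {Y : Type u'} [SeminormedAddCommGroup X] [NormedSpace ℝ X]
    [SeminormedAddCommGroup Y] [NormedSpace ℝ Y] (C : ℝ) (x : ι → X) (y : ι → Y) : Prop :=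
  ∀ (n : ℕ) (a : Fin n → ℝ) (i : Fin n → ι), StrictMono i →
    C⁻¹ * ‖∑ k, a k • x (i k)‖ ≤ ‖∑ k, a k • y (i k)‖ ∧
      ‖∑ k, a k • y (i k)‖ ≤ C * ‖∑ k, a k • x (i k)‖

/-- Two families are *equivalent* if they are `C`-equivalent for some finite `C > 0`. -/
def SeqEquiv {X : Type u} {Y : Type u'} [SeminormedAddCommGroup X] [NormedSpace ℝ X]
    [SeminormedAddCommGroup Y] [NormedSpace ℝ Y] (x : ι → X) (y : ι → Y) : Prop :=
  ∃ C : ℝ, 0 < C ∧ SeqCEquiv C x y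

/-- `x` is equivalent to a symmetric sequence (in some real Banach space). -/
def EquivToSymm {X : Type u} [SeminormedAddCommGroup X] [NormedSpace ℝ X] (x : ι → X) : Prop :=
  ∃ (Y : BanachSpace.{u}) (y : ι → Y.carrier), IsSymmSeq y ∧ SeqEquiv x y

end Seq

section Unconditional

variable {ι : Type v} [LinearOrder ι] {X : Type u} [NormedAddCommGroup X] [NormedSpace ℝ X]
  {x : ι → X}

/-- Every increasing finite linear combination of a 1-unconditional family shrinks in norm under
multiplication of the coefficients by numbers of absolute value at most one. -/
theorem IsUnconditionalSeq.norm_sum_mul_le (hx : IsUnconditionalSeq x) {n : ℕ}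
    {i : Fin n → ι} (hi : StrictMono i) (θ a : Fin n → ℝ) (hθ : ∀ k, |θ k| ≤ 1) :
    ‖∑ k, (θ k * a k) • x (i k)‖ ≤ ‖∑ k, a k • x (i k)‖ := by
  let L : (Fin n → ℝ) →ₗ[ℝ] X :=
    { toFun := fun θ => ∑ k, (θ k * a k) • x (i k)
      map_add' := fun θ η => by
        simp only [Pi.add_apply, add_mul, add_smul, Finset.sum_add_distrib]
      map_smul' := fun c θ => by
        simp only [Pi.smul_apply, smul_eq_mul, mul_assoc, mul_smul, Finset.smul_sum,
          RingHom.id_apply] }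
  have hconv : ConvexOn ℝ Set.univ fun θ => ‖L θ‖ := convexOn_univ_norm.comp_linearMap L
  have hmem : θ ∈ convexHull ℝ (Set.univ.pi fun _ : Fin n => ({-1, 1} : Set ℝ)) := by
    rw [convexHull_pi]
    intro k _
    rw [convexHull_pair, segment_eq_Icc (by norm_num)]
    exact abs_le.mp (hθ k)
  obtain ⟨ε, hε, hle⟩ := hconv.exists_ge_of_mem_convexHull (Set.subset_univ _) hmem
  refine hle.trans (hx n a ε i hi fun k => ?_).le
  exact (hε k (Set.mem_univ k)).symm

theorem IsUnconditionalSeq.norm_finset_sum_mul_le (hx : IsUnconditionalSeq x) (F : Finset ι)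
    (θ c : ι → ℝ) (hθ : ∀ i ∈ F, |θ i| ≤ 1) :
    ‖∑ i ∈ F, (θ i * c i) • x i‖ ≤ ‖∑ i ∈ F, c i • x i‖ := by
  have key (g : ι → X) : ∑ i ∈ F, g i = ∑ k, g (F.orderEmbOfFin rfl k) := by
    conv_lhs => rw [← F.map_orderEmbOfFin_univ rfl, Finset.sum_map]
    rfl
  rw [key, key]
  exact hx.norm_sum_mul_le (F.orderEmbOfFin rfl).strictMono _ _
    fun k => hθ _ (F.orderEmbOfFin_mem rfl k)

theorem IsUnconditionalSeq.norm_finset_sum_mul_le_linearCombination (hx : IsUnconditionalSeq x)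
    (F : Finset ι) (θ : ι → ℝ) (hθ : ∀ i ∈ F, |θ i| ≤ 1) (c : ι →₀ ℝ) :
    ‖∑ i ∈ F, (θ i * c i) • x i‖ ≤ ‖Finsupp.linearCombination ℝ x c‖ := by
  classical
  have h := hx.norm_finset_sum_mul_le (F ∪ c.support) (fun i => if i ∈ F then θ i else 0) c
    (fun i _ => by
      by_cases hi : i ∈ F
      · simpa [hi] using hθ i hi
      · simp [hi])
  have h₁ : ∑ i ∈ F ∪ c.support, ((if i ∈ F then θ i else 0) * c i) • x i =
      ∑ i ∈ F, (θ i * c i) • x i := by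
    rw [← Finset.sum_subset Finset.subset_union_left]
    · exact Finset.sum_congr rfl fun i hi => by simp [hi]
    · intro i _ hi
      simp [hi]
  have h₂ : ∑ i ∈ F ∪ c.support, c i • x i = Finsupp.linearCombination ℝ x c := by
    rw [Finsupp.linearCombination_apply, Finsupp.sum, ← Finset.sum_subset Finset.subset_union_right]
    intro i _ hi
    simp [Finsupp.notMem_support_iff.mp hi]
  rwa [h₁, h₂] at h

theorem IsUnconditionalSeq.abs_mul_norm_le (hx : IsUnconditionalSeq x) (c : ι →₀ ℝ) (i : ι) :
    |c i| * ‖x i‖ ≤ ‖Finsupp.linearCombination ℝ x c‖ := by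
  simpa [norm_smul] using
    hx.norm_finset_sum_mul_le_linearCombination {i} (fun _ => 1) (by simp) c

theorem IsUnconditionalSeq.linearIndependent (hx : IsUnconditionalSeq x) (h0 : ∀ i, x i ≠ 0) :
    LinearIndependent ℝ x := by
  rw [linearIndependent_iff]
  intro c hc
  ext i
  have h := hx.abs_mul_norm_le c i
  rw [hc, norm_zero] at h
  have := norm_pos_iff.mpr (h0 i)
  simpa using abs_nonpos_iff.mp (nonpos_of_mul_nonpos_left h this)

/-- Coordinate functionals of a nowhere vanishing 1-unconditional family with dense span: signed
partial sums of the coordinate expansion are contractive, and the functionals separate points. -/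
theorem IsUnconditionalSeq.exists_coord (hx : IsUnconditionalSeq x) (h0 : ∀ i, x i ≠ 0)
    (hspan : (Submodule.span ℝ (Set.range x)).topologicalClosure = ⊤) :
    ∃ f : ι → X →L[ℝ] ℝ,
      (∀ (F : Finset ι) (θ : ι → ℝ), (∀ i ∈ F, |θ i| ≤ 1) → ∀ v,
        ‖∑ i ∈ F, (θ i * f i v) • x i‖ ≤ ‖v‖) ∧
      ∀ v, (∀ i, f i v = 0) → v = 0 := by
  have hli := hx.linearIndependent h0
  have hdense : Dense (Submodule.span ℝ (Set.range x) : Set X) :=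
    Submodule.dense_iff_topologicalClosure_eq_top.mpr hspan
  have hcomb (w : Submodule.span ℝ (Set.range x)) :
      Finsupp.linearCombination ℝ x (hli.repr w) = w := hli.linearCombination_repr w
  have hext (i : ι) : ∃ f : X →L[ℝ] ℝ,
      ∀ w : Submodule.span ℝ (Set.range x), f w = hli.repr w i := by
    let g : Submodule.span ℝ (Set.range x) →L[ℝ] ℝ :=
      LinearMap.mkContinuous ((Finsupp.lapply i).comp hli.repr) ‖x i‖⁻¹ fun w => by
        have h := hx.abs_mul_norm_le (hli.repr w) i
        rw [hcomb] at h
        have hpos := norm_pos_iff.mpr (h0 i)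
        rw [inv_mul_eq_div, le_div_iff₀ hpos]
        exact h
    obtain ⟨f, hf, -⟩ := exists_extension_norm_eq (Submodule.span ℝ (Set.range x)) g
    exact ⟨f, fun w => hf w⟩
  choose f hf using hext
  have hcontr (F : Finset ι) (θ : ι → ℝ) (hθ : ∀ i ∈ F, |θ i| ≤ 1) (v : X) :
      ‖∑ i ∈ F, (θ i * f i v) • x i‖ ≤ ‖v‖ := by
    refine hdense.induction (P := fun v => ‖∑ i ∈ F, (θ i * f i v) • x i‖ ≤ ‖v‖) ?_ ?_ v
    · intro w hw
      have h := hx.norm_finset_sum_mul_le_linearCombination F θ hθ (hli.repr ⟨w, hw⟩)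
      rw [hcomb] at h
      simpa only [← hf] using h
    · exact isClosed_le (by fun_prop) continuous_norm
  refine ⟨f, hcontr, fun v hv => ?_⟩
  have hsmall : ∀ w ∈ (Submodule.span ℝ (Set.range x) : Set X), ‖w‖ ≤ ‖w - v‖ := by
    intro w hw
    have h := hcontr (hli.repr ⟨w, hw⟩).support (fun _ => 1) (by simp) (w - v)
    have hsum : ∑ i ∈ (hli.repr ⟨w, hw⟩).support, ((1 : ℝ) * f i (w - v)) • x i = w := by
      have := hcomb ⟨w, hw⟩
      rw [Finsupp.linearCombination_apply, Finsupp.sum] at this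
      simpa [hv, hf _ ⟨w, hw⟩] using this
    rwa [hsum] at h
  have hv : ‖v‖ ≤ ‖v - v‖ :=
    hdense.induction (P := fun w => ‖w‖ ≤ ‖w - v‖) hsmall
      (isClosed_le continuous_norm (by fun_prop)) v
  simpa using hv

end Unconditional

section Diagonal

theorem sum_units_pi_mul_eq_zero {n : ℕ} {k j : Fin n} (hkj : k ≠ j) :
    ∑ ε : Fin n → ℤˣ, (((ε k : ℤ) : ℝ) * ((ε j : ℤ) : ℝ)) = 0 := by
  have h : ∑ ε : Fin n → ℤˣ, (((ε k : ℤ) : ℝ) * ((ε j : ℤ) : ℝ)) =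
      ∑ ε : Fin n → ℤˣ, -(((ε k : ℤ) : ℝ) * ((ε j : ℤ) : ℝ)) := by
    refine Fintype.sum_equiv (Equiv.mulLeft (Pi.mulSingle k (-1))) _ _ fun ε => ?_
    simp [Pi.mulSingle_eq_of_ne hkj.symm]
  rw [Finset.sum_neg_distrib] at h
  linarith

theorem sum_units_pi_signed_matrix {Y : Type*} [AddCommGroup Y] [Module ℝ Y] {n : ℕ}
    (m : Fin n → Fin n → ℝ) (y : Fin n → Y) :
    ∑ ε : Fin n → ℤˣ, ∑ k, (((ε k : ℤ) : ℝ) * ∑ j, ((ε j : ℤ) : ℝ) * m k j) • y k =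
      (Fintype.card (Fin n → ℤˣ) : ℝ) • ∑ k, m k k • y k := by
  rw [Finset.sum_comm, Finset.smul_sum]
  refine Finset.sum_congr rfl fun k _ => ?_
  rw [← Finset.sum_smul, smul_smul]
  congr 1
  simp_rw [Finset.mul_sum, ← mul_assoc]
  rw [Finset.sum_comm, Finset.sum_eq_single k]
  · have h (ε : Fin n → ℤˣ) : ((ε k : ℤ) : ℝ) * ((ε k : ℤ) : ℝ) = 1 := by
      rw [← Int.cast_mul, Int.units_coe_mul_self, Int.cast_one]
    simp [h]
  · intro j _ hj
    rw [← Finset.sum_mul, sum_units_pi_mul_eq_zero hj.symm, zero_mul]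
  · simp

theorem units_int_cast_eq_one_or_neg_one (s : ℤˣ) :
    ((s : ℤ) : ℝ) = 1 ∨ ((s : ℤ) : ℝ) = -1 := by
  rcases Int.units_eq_one_or s with rfl | rfl <;> simp

variable {ι : Type v} [LinearOrder ι] {X Y : Type u} [NormedAddCommGroup X] [NormedSpace ℝ X]
  [NormedAddCommGroup Y] [NormedSpace ℝ Y] {x : ι → X} {y : ι → Y}

/-- The diagonal of the matrix of a bounded operator with respect to 1-unconditional families
defines an operator of no larger norm. -/
theorem IsUnconditionalSeq.norm_diagonal_le (hx : IsUnconditionalSeq x) (f : ι → Y →L[ℝ] ℝ)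
    (hf : ∀ (F : Finset ι) (θ : ι → ℝ), (∀ i ∈ F, |θ i| ≤ 1) → ∀ v,
      ‖∑ i ∈ F, (θ i * f i v) • y i‖ ≤ ‖v‖)
    (T : X →L[ℝ] Y) {n : ℕ} {α γ : Fin n → ι} (hα : StrictMono α) (hγ : StrictMono γ)
    (a : Fin n → ℝ) :
    ‖∑ k, (a k * f (γ k) (T (x (α k)))) • y (γ k)‖ ≤ ‖T‖ * ‖∑ k, a k • x (α k)‖ := by
  have hf' (θ : Fin n → ℝ) (hθ : ∀ k, |θ k| ≤ 1) (v : Y) :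
      ‖∑ k, (θ k * f (γ k) v) • y (γ k)‖ ≤ ‖v‖ := by
    have h := hf (Finset.univ.map ⟨γ, hγ.injective⟩) (Function.extend γ θ 0) (fun i hi => by
      obtain ⟨k, -, rfl⟩ := Finset.mem_map.mp hi
      simpa [hγ.injective.extend_apply] using hθ k) v
    simpa [hγ.injective.extend_apply] using h
  set N : ℝ := (Fintype.card (Fin n → ℤˣ) : ℝ) with hN
  have hNpos : 0 < N := by
    rw [hN]
    exact_mod_cast Fintype.card_pos
  have hbound (ε : Fin n → ℤˣ) :
      ‖∑ k, (((ε k : ℤ) : ℝ) * ∑ j, ((ε j : ℤ) : ℝ) *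
        (a j * f (γ k) (T (x (α j))))) • y (γ k)‖ ≤ ‖T‖ * ‖∑ k, a k • x (α k)‖ := by
    have h := hf' (fun k => ((ε k : ℤ) : ℝ))
      (fun k => by rcases units_int_cast_eq_one_or_neg_one (ε k) with h | h <;> simp [h])
      (T (∑ j, (((ε j : ℤ) : ℝ) * a j) • x (α j)))
    have h' := T.le_opNorm (∑ j, (((ε j : ℤ) : ℝ) * a j) • x (α j))
    rw [hx n a (fun j => ((ε j : ℤ) : ℝ)) α hα
      fun k => units_int_cast_eq_one_or_neg_one (ε k)] at h'
    refine le_trans (le_of_eq ?_) (h.trans h')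
    simp only [map_sum, map_smul, smul_eq_mul, mul_assoc]
  have hsum := norm_sum_le_of_le Finset.univ fun ε (_ : ε ∈ Finset.univ) => hbound ε
  rw [sum_units_pi_signed_matrix (fun k j => a j * f (γ k) (T (x (α j)))) fun k => y (γ k),
    norm_smul, Finset.sum_const, nsmul_eq_mul, Finset.card_univ, ← hN,
    Real.norm_of_nonneg hNpos.le] at hsum
  exact le_of_mul_le_mul_left hsum hNpos

end Diagonal

section Domination

theorem exists_strictMono_comp_of_injective {β : Type*} [LinearOrder β] [WellFoundedLT β]
    {g : ℕ → β} (hg : Function.Injective g) : ∃ φ : ℕ → ℕ, StrictMono φ ∧ StrictMono (g ∘ φ) := by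
  obtain ⟨φ, h | h⟩ := exists_increasing_or_nonincreasing_subseq (· < ·) g
  · exact ⟨φ, φ.strictMono, fun m n hmn => h m n hmn⟩
  · have hanti : StrictAnti fun n => g (φ n) := fun m n hmn =>
      lt_of_le_of_ne (not_lt.mp (h m n hmn)) fun he => hmn.ne' (φ.injective (hg he))
    exact absurd hanti (by
      intro h
      exact (RelEmbedding.natGT _ fun n => h n.lt_succ_self).not_wellFounded wellFounded_lt)

theorem Set.Infinite.exists_strictMono_nat {β : Type*} [LinearOrder β] [WellFoundedLT β]
    {S : Set β} (hS : S.Infinite) : ∃ s : ℕ → β, StrictMono s ∧ ∀ n, s n ∈ S := by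
  obtain ⟨φ, -, h⟩ := exists_strictMono_comp_of_injective
    (Subtype.val_injective.comp (hS.natEmbedding S).injective)
  exact ⟨_, h, fun n => Subtype.property _⟩

/-- A map with finite fibers on an infinite set is strictly increasing along some sequence. -/
theorem Set.Infinite.exists_strictMono_nat_comp {β δ : Type*} [LinearOrder β] [WellFoundedLT β]
    [LinearOrder δ] [WellFoundedLT δ] {S : Set β} (hS : S.Infinite) (γ : β → δ)
    (hγ : ∀ i, (S ∩ γ ⁻¹' {i}).Finite) :
    ∃ s : ℕ → β, StrictMono s ∧ StrictMono (γ ∘ s) ∧ ∀ n, s n ∈ S := by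
  have himage : (γ '' S).Infinite := fun h => hS (h.of_finite_fibers γ fun i _ => hγ i)
  obtain ⟨R, hRS, hR⟩ := Set.exists_subset_bijOn S γ
  have hRinf : R.Infinite := fun h => himage (hR.image_eq ▸ h.image γ)
  obtain ⟨s, hs, hsR⟩ := hRinf.exists_strictMono_nat
  obtain ⟨φ, hφ, hγφ⟩ := exists_strictMono_comp_of_injective (g := γ ∘ s)
    fun m n h => hs.injective (hR.injOn (hsR m) (hsR n) h)
  exact ⟨s ∘ φ, hs.comp hφ, hγφ, fun n => hRS (hsR _)⟩

variable {ι : Type v} [LinearOrder ι] {X Y : Type u} [NormedAddCommGroup X] [NormedSpace ℝ X]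
  [NormedAddCommGroup Y] [NormedSpace ℝ Y] {x : ι → X} {y : ι → Y}

theorem IsSpreading.norm_eq (hx : IsSpreading x) (i j : ι) : ‖x i‖ = ‖x j‖ := by
  simpa using hx 1 (fun _ => 1) (fun _ => i) (fun _ => j) (Subsingleton.strictMono _)
    (Subsingleton.strictMono _)

/-- A functional that is bounded away from zero along a sequence in a subsymmetric family forces a
lower `ℓ₁` estimate. -/
theorem IsSubsymmetric.mul_sum_abs_le (hx : IsSubsymmetric x) (f : X →L[ℝ] ℝ) {δ : ℝ}
    {s : ℕ → ι} (hs : StrictMono s) (hf : ∀ n, δ ≤ |f (x (s n))|) {n : ℕ} (a : Fin n → ℝ)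
    {i : Fin n → ι} (hi : StrictMono i) :
    δ * ∑ k, |a k| ≤ ‖f‖ * ‖∑ k, a k • x (i k)‖ := by
  let α : Fin n → ι := fun k => s k
  have hα : StrictMono α := fun k l hkl => hs hkl
  let θ : Fin n → ℝ := fun k => SignType.sign (a k * f (x (α k)))
  have hθ (k : Fin n) : |θ k| ≤ 1 := by
    rcases h : SignType.sign (a k * f (x (α k))) <;> simp [θ, h]
  have h₁ := hx.2.norm_sum_mul_le hα θ a hθ
  have h₂ : f (∑ k, (θ k * a k) • x (α k)) = ∑ k, |a k| * |f (x (α k))| := by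
    simp only [map_sum, map_smul, smul_eq_mul, mul_assoc, θ, ← abs_mul, sign_mul_self]
  calc δ * ∑ k, |a k| ≤ ∑ k, |a k| * |f (x (α k))| := by
        rw [Finset.mul_sum]
        refine Finset.sum_le_sum fun k _ => ?_
        rw [mul_comm]
        exact mul_le_mul_of_nonneg_left (hf k) (abs_nonneg _)
    _ ≤ ‖f (∑ k, (θ k * a k) • x (α k))‖ := by
        rw [h₂]
        exact le_abs_self _
    _ ≤ ‖f‖ * ‖∑ k, (θ k * a k) • x (α k)‖ := f.le_opNorm _
    _ ≤ ‖f‖ * ‖∑ k, a k • x (i k)‖ := by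
        rw [hx.1 n a i α hi hα]
        gcongr

/-- If the closed span of an uncountable subsymmetric family `x` embeds into the closed span of a
subsymmetric family `y` via an injective operator, then `x` dominates `y`. -/
theorem IsSubsymmetric.exists_norm_sum_le [WellFoundedLT ι] [Uncountable ι]
    (hx : IsSubsymmetric x) (hy : IsSubsymmetric y) (hx0 : ∀ i, x i ≠ 0) (hy0 : ∀ i, y i ≠ 0)
    (hyspan : (Submodule.span ℝ (Set.range y)).topologicalClosure = ⊤)
    (T : X →L[ℝ] Y) (hT : Function.Injective T) :
    ∃ C : ℝ, ∀ (n : ℕ) (a : Fin n → ℝ) (i : Fin n → ι), StrictMono i →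
      ‖∑ k, a k • y (i k)‖ ≤ C * ‖∑ k, a k • x (i k)‖ := by
  obtain ⟨f, hf, hsep⟩ := hy.2.exists_coord hy0 hyspan
  have hex (α : ι) : ∃ γ, f γ (T (x α)) ≠ 0 := by
    by_contra! h
    exact hx0 α (hT (by rw [hsep _ h, map_zero]))
  choose γ hγ using hex
  obtain ⟨m, hm⟩ : ∃ m : ℕ, {α | 1 / ((m : ℝ) + 1) < |f (γ α) (T (x α))|}.Infinite := by
    by_contra! h
    have hcount := Set.countable_iUnion fun m => (h m).countable
    refine Set.not_countable_univ (α := ι) (hcount.mono fun α _ => Set.mem_iUnion.mpr ?_)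
    exact exists_nat_one_div_lt (abs_pos.mpr (hγ α))
  set δ : ℝ := 1 / ((m : ℝ) + 1)
  have hδ : 0 < δ := by positivity
  set S : Set ι := {α | δ < |f (γ α) (T (x α))|}
  by_cases hfib : ∀ i, (S ∩ γ ⁻¹' {i}).Finite
  · obtain ⟨s, hs, hγs, hsS⟩ := hm.exists_strictMono_nat_comp γ hfib
    refine ⟨δ⁻¹ * ‖T‖, fun n a i hi => ?_⟩
    let α : Fin n → ι := fun k => s k
    have hα : StrictMono α := fun k l hkl => hs hkl
    have hγα : StrictMono fun k => γ (α k) := fun k l hkl => hγs hkl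
    have hdiag := hx.2.norm_diagonal_le f hf T hα hγα a
    have hpos (k : Fin n) : δ < |f (γ (α k)) (T (x (α k)))| := hsS k
    have hne (k : Fin n) : f (γ (α k)) (T (x (α k))) ≠ 0 := abs_pos.mp (hδ.trans (hpos k))
    have hmul := hy.2.norm_sum_mul_le hγα (fun k => δ * (f (γ (α k)) (T (x (α k))))⁻¹)
      (fun k => a k * f (γ (α k)) (T (x (α k)))) fun k => by
        rw [abs_mul, abs_inv, abs_of_pos hδ, ← div_eq_mul_inv, div_le_one (hδ.trans (hpos k))]
        exact (hpos k).le
    have hcoef (k : Fin n) : δ * (f (γ (α k)) (T (x (α k))))⁻¹ *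
        (a k * f (γ (α k)) (T (x (α k)))) = δ * a k := by
      have := hne k
      field_simp
    simp only [hcoef, mul_smul, ← Finset.smul_sum] at hmul
    rw [norm_smul, Real.norm_of_nonneg hδ.le, hy.1 n a _ i hγα hi] at hmul
    simp only [← mul_smul] at hmul
    rw [hx.1 n a i α hi hα, mul_assoc, inv_mul_eq_div, le_div_iff₀ hδ, mul_comm]
    exact hmul.trans hdiag
  · push Not at hfib
    obtain ⟨i₀, hi₀⟩ := hfib
    obtain ⟨s, hs, hsS⟩ := Set.Infinite.exists_strictMono_nat hi₀
    refine ⟨‖y i₀‖ * (δ⁻¹ * ‖(f i₀).comp T‖), fun n a i hi => ?_⟩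
    have hl1 := hx.mul_sum_abs_le ((f i₀).comp T) (δ := δ) hs (fun n => by
      have h := hsS n
      have h₂ : γ (s n) = i₀ := h.2
      have h₁ : δ < |f (γ (s n)) (T (x (s n)))| := h.1
      rw [h₂] at h₁
      exact h₁.le) a hi
    calc ‖∑ k, a k • y (i k)‖ ≤ ∑ k, |a k| * ‖y i₀‖ := by
          refine norm_sum_le_of_le _ fun k _ => ?_
          rw [norm_smul, hy.1.norm_eq (i k) i₀, Real.norm_eq_abs]
      _ = ‖y i₀‖ * ∑ k, |a k| := by rw [← Finset.sum_mul, mul_comm]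
      _ ≤ ‖y i₀‖ * (δ⁻¹ * (‖(f i₀).comp T‖ * ‖∑ k, a k • x (i k)‖)) := by
          gcongr
          rw [inv_mul_eq_div, le_div_iff₀ hδ, mul_comm]
          exact hl1
      _ = _ := by ring

theorem seqEquiv_of_norm_sum_le {C D : ℝ}
    (hC : ∀ (n : ℕ) (a : Fin n → ℝ) (i : Fin n → ι), StrictMono i →
      ‖∑ k, a k • y (i k)‖ ≤ C * ‖∑ k, a k • x (i k)‖)
    (hD : ∀ (n : ℕ) (a : Fin n → ℝ) (i : Fin n → ι), StrictMono i →
      ‖∑ k, a k • x (i k)‖ ≤ D * ‖∑ k, a k • y (i k)‖) : SeqEquiv x y := by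
  have hpos : 0 < max (max C D) 1 := lt_max_of_lt_right one_pos
  refine ⟨max (max C D) 1, hpos, fun n a i hi => ⟨?_, ?_⟩⟩
  · rw [inv_mul_le_iff₀ hpos]
    refine (hD n a i hi).trans ?_
    gcongr
    exact (le_max_right C D).trans (le_max_left _ _)
  · refine (hC n a i hi).trans ?_
    gcongr
    exact (le_max_left C D).trans (le_max_left _ _)

theorem IsSpreading.subsingleton_of_eq_zero (hx : IsSpreading x)
    (hspan : (Submodule.span ℝ (Set.range x)).topologicalClosure = ⊤) {i : ι} (hi : x i = 0) :
    Subsingleton X := by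
  have hzero : Set.range x ⊆ {0} := by
    rintro _ ⟨j, rfl⟩
    have h := hx.norm_eq j i
    rw [hi, norm_zero, norm_eq_zero] at h
    exact h
  have hbot : Submodule.span ℝ (Set.range x) = ⊥ := Submodule.span_eq_bot.mpr hzero
  refine subsingleton_of_forall_eq 0 fun v => ?_
  have hv : v ∈ (Submodule.span ℝ (Set.range x)).topologicalClosure := hspan ▸ Submodule.mem_top
  rw [← SetLike.mem_coe, Submodule.topologicalClosure_coe, hbot] at hv
  simpa using hv

end Domination

/-- If `κ > ω`, `(x_α)_{α<κ}` and `(y_α)_{α<κ}` are subsymmetric `κ`-sequences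
spanning dense subspaces of real Banach spaces `X` and `Y` respectively, and `X` and `Y` are
isomorphic (linearly homeomorphic), then the two families are equivalent. -/
theorem subsymmetric_isomorphic_spans_implies_equiv
    {X Y : Type u} [NormedAddCommGroup X] [NormedSpace ℝ X] [CompleteSpace X]
    [NormedAddCommGroup Y] [NormedSpace ℝ Y] [CompleteSpace Y]
    (κ : Cardinal.{v}) (hκ : Cardinal.aleph0 < κ)
    (x : Set.Iio κ.ord → X) (y : Set.Iio κ.ord → Y)
    (hx : IsSubsymmetric x) (hy : IsSubsymmetric y)
    (hxspan : (Submodule.span ℝ (Set.range x)).topologicalClosure = ⊤)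
    (hyspan : (Submodule.span ℝ (Set.range y)).topologicalClosure = ⊤)
    (hiso : Nonempty (X ≃L[ℝ] Y)) :
    SeqEquiv x y := by
  obtain ⟨T⟩ := hiso
  have : Uncountable (Set.Iio κ.ord) := by
    rw [← Cardinal.aleph0_lt_mk_iff, Cardinal.mk_Iio_ordinal, Cardinal.card_ord,
      Cardinal.aleph0_lt_lift]
    exact hκ
  by_cases hX : Subsingleton X
  · have hY : Subsingleton Y := T.symm.injective.subsingleton
    exact seqEquiv_of_norm_sum_le (C := 0) (D := 0)
      (fun n a i _ => by rw [Subsingleton.elim (∑ k, a k • y (i k)) 0]; simp)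
      (fun n a i _ => by rw [Subsingleton.elim (∑ k, a k • x (i k)) 0]; simp)
  · have hx0 : ∀ i, x i ≠ 0 := fun i hi => hX (hx.1.subsingleton_of_eq_zero hxspan hi)
    have hy0 : ∀ i, y i ≠ 0 := fun i hi => hX
      (have := hy.1.subsingleton_of_eq_zero hyspan hi
       T.injective.subsingleton)
    obtain ⟨C, hC⟩ := hx.exists_norm_sum_le hy hx0 hy0 hyspan (T : X →L[ℝ] Y) T.injective
    obtain ⟨D, hD⟩ := hy.exists_norm_sum_le hx hy0 hx0 hxspan (T.symm : Y →L[ℝ] X)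
      T.symm.injective
    exact seqEquiv_of_norm_sum_le hC hD
end
end

section
/- (Keisler–Shelah theorem for Banach spaces) For every Banach space X and every pair of ultrafilters D and E, there exists an ultrafilter G such that the iterated ultrapowers ((X)_D)_G and ((X)_E)_G are isometrically isomorphic. In particular, X ≡ (X)_D for every ultrafilter D. -/
open Filter Topology
open scoped ENNReal

noncomputable section

universe u

/-- The subspace `N_D ⊆ ℓ∞(I, X)` of families whose norms tend to `0` along the
ultrafilter `D`. -/
def ultraNullIdeal (I : Type u) (D : Ultrafilter I) (X : Type u)
    [NormedAddCommGroup X] [NormedSpace ℝ X] :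
    Submodule ℝ (lp (fun _ : I => X) ∞) where
  carrier := {f | Filter.Tendsto (fun i => ‖f i‖) (D : Filter I) (nhds 0)}
  zero_mem' := by
    simpa using (tendsto_const_nhds :
      Filter.Tendsto (fun _ : I => (0 : ℝ)) (D : Filter I) (nhds 0))
  add_mem' := by
    intro f g hf hg
    have h := hf.add hg
    rw [add_zero] at h
    refine squeeze_zero (fun i => norm_nonneg _) (fun i => ?_) h
    simpa using norm_add_le (f i) (g i)
  smul_mem' := by
    intro c f hf
    have h : Filter.Tendsto (fun i => ‖c‖ * ‖f i‖) (D : Filter I) (nhds 0) := by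
      simpa using hf.const_mul ‖c‖
    refine squeeze_zero (fun i => norm_nonneg _) (fun i => ?_) h
    simp [norm_smul]

/-- The Banach-space ultrapower `(X)_D = ℓ∞(I,X) / N_D`, with the quotient norm. -/
abbrev Ultrapower (I : Type u) (D : Ultrafilter I) (X : Type u)
    [NormedAddCommGroup X] [NormedSpace ℝ X] : Type u :=
  lp (fun _ : I => X) ∞ ⧸ ultraNullIdeal I D X

/-- The bounded family constantly equal to `x`, as an element of `ℓ∞(I, X)`. -/
def constLp (I : Type u) (X : Type u) [NormedAddCommGroup X] [NormedSpace ℝ X] (x : X) :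
    lp (fun _ : I => X) ∞ :=
  ⟨fun _ => x, memℓp_infty ⟨‖x‖, by rintro r ⟨i, rfl⟩; exact le_rfl⟩⟩

/-- The canonical (diagonal) embedding `d_X : X → (X)_D`. -/
def diagEmbedding (I : Type u) (D : Ultrafilter I) (X : Type u)
    [NormedAddCommGroup X] [NormedSpace ℝ X] (x : X) : Ultrapower I D X :=
  Submodule.Quotient.mk (constLp I X x)

/-- The null ideal is a closed subspace of `ℓ∞(I, X)`, so the ultrapower is a normed
(indeed Banach) space. -/
theorem ultraNullIdeal_isClosed (I : Type u) (D : Ultrafilter I) (X : Type u)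
    [NormedAddCommGroup X] [NormedSpace ℝ X] :
    IsClosed ((ultraNullIdeal I D X : Set (lp (fun _ : I => X) ∞))) := by
  refine isClosed_of_closure_subset ?_
  intro f hf
  rw [Metric.mem_closure_iff] at hf
  rw [SetLike.mem_coe]
  change Filter.Tendsto (fun i => ‖f i‖) (D : Filter I) (nhds 0)
  rw [Metric.tendsto_nhds]
  intro ε hε
  obtain ⟨g, hg, hfg⟩ := hf (ε / 2) (by positivity)
  have hgt : ∀ᶠ i in (D : Filter I), dist ‖g i‖ 0 < ε / 2 := by
    have hg' : Filter.Tendsto (fun i => ‖g i‖) (D : Filter I) (nhds 0) := hg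
    exact (Metric.tendsto_nhds.mp hg') (ε / 2) (by positivity)
  refine hgt.mono fun i hi => ?_
  have h1 : ‖f i - g i‖ ≤ ‖f - g‖ := by
    have := lp.norm_apply_le_norm (E := fun _ : I => X) (p := ∞) (by simp) (f - g) i
    simpa using this
  have h2 : ‖f - g‖ < ε / 2 := by rwa [dist_eq_norm] at hfg
  have h3 : ‖g i‖ < ε / 2 := by
    simpa [Real.dist_eq, abs_of_nonneg (norm_nonneg _)] using hi
  have h4 : ‖f i‖ ≤ ‖f i - g i‖ + ‖g i‖ := by
    simpa using norm_add_le (f i - g i) (g i)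
  have : ‖f i‖ < ε := by linarith
  simpa [Real.dist_eq, abs_of_nonneg (norm_nonneg _)] using this

instance (I : Type u) (D : Ultrafilter I) (X : Type u)
    [NormedAddCommGroup X] [NormedSpace ℝ X] :
    IsClosed ((ultraNullIdeal I D X : Set (lp (fun _ : I => X) ∞))) :=
  ultraNullIdeal_isClosed I D X

/-- Banach spaces `X` and `Y` are *elementary equivalent* if some ultrapowers `(X)_G` and
`(Y)_G` are isometrically isomorphic. -/
def ElemEquiv (X Y : Type u) [NormedAddCommGroup X] [NormedSpace ℝ X]
    [NormedAddCommGroup Y] [NormedSpace ℝ Y] : Prop :=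
  ∃ (K : Type u) (G : Ultrafilter K),
    Nonempty (Ultrapower K G X ≃ₗᵢ[ℝ] Ultrapower K G Y)

open Cardinal in
/-- `Z` meets every system of at most `κ` prescriptions `f φ = p φ` with `φ ∉ U`. -/
def IndepOff {Φ Λ S : Type u} (f : Φ → Λ → S) (κ : Cardinal.{u}) (U : Set Φ) (Z : Set Λ) : Prop :=
  ∀ V : Set Φ, Disjoint V U → #V ≤ κ → ∀ p : Φ → S, ∃ ξ ∈ Z, ∀ φ ∈ V, f φ ξ = p φ

theorem IndepOff.mono {Φ Λ S : Type u} {f : Φ → Λ → S} {κ : Cardinal.{u}} {U U' : Set Φ}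
    {Z Z' : Set Λ} (h : IndepOff f κ U Z) (hU : U ⊆ U') (hZ : Z ⊆ Z') : IndepOff f κ U' Z' := by
  intro V hV hVκ p
  obtain ⟨ξ, hξ, hp⟩ := h V (hV.mono_right hU) hVκ p
  exact ⟨ξ, hZ hξ, hp⟩

open Cardinal in
/-- Given `g`, after discarding at most `κ` further indices every remaining `f φ` can be forced to
agree with `g` without destroying independence. -/
theorem IndepOff.exists_avoid {Φ Λ S : Type u} [Nonempty S] {f : Φ → Λ → S}
    {κ : Cardinal.{u}} {U : Set Φ} {Z : Set Λ} (hκ : ℵ₀ ≤ κ) (hS : #S ≤ κ) (h : IndepOff f κ U Z) (g : Λ → S) :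
    ∃ B : Set Φ, #B ≤ κ ∧ ∀ U' : Set Φ, U ∪ B ⊆ U' → ∀ φ ∉ U',
      IndepOff f κ (insert φ U') (Z ∩ {ξ | f φ ξ = g ξ}) := by
  classical
  let Bad : Set Φ → Prop := fun T => Disjoint T U ∧ #T ≤ κ ∧ ∃ φ ∈ T, ∃ p : Φ → S,
    ∀ ξ ∈ Z, f φ ξ = g ξ → ¬ ∀ ψ ∈ T, ψ ≠ φ → f ψ ξ = p ψ
  obtain ⟨F, hF⟩ := zorn_subset {F : Set (Set Φ) | (∀ T ∈ F, Bad T) ∧ F.PairwiseDisjoint id} (by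
    intro c hc hchain
    refine ⟨⋃₀ c, ⟨?_, ?_⟩, fun s hs => Set.subset_sUnion_of_mem hs⟩
    · rintro T ⟨s, hs, hT⟩
      exact (hc hs).1 T hT
    · rintro T ⟨s, hs, hT⟩ T' ⟨s', hs', hT'⟩ hne
      rcases hchain.total hs hs' with h1 | h1
      · exact (hc hs').2 (h1 hT) hT' hne
      · exact (hc hs).2 hT (h1 hT') hne)
  have hFS : #F ≤ #S := by
    by_contra! hlt
    obtain ⟨e⟩ := Cardinal.le_def S F |>.1 hlt.le
    have hbad : ∀ s, Bad (e s) := fun s => hF.prop.1 _ (e s).2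
    choose hdis hcard φ hφ p hp using hbad
    have huniq : ∀ s t ψ, ψ ∈ (e s : Set Φ) → ψ ∈ (e t : Set Φ) → s = t := by
      intro s t ψ hs ht
      by_contra hne
      have : (e s : Set Φ) ≠ e t := fun h' => hne (e.injective (Subtype.ext h'))
      exact Set.disjoint_left.1 (hF.prop.2 (e s).2 (e t).2 this) hs ht
    let V : Set Φ := ⋃ s, (e s : Set Φ)
    have hV : #V ≤ κ := by
      refine (mk_iUnion_le _).trans ?_
      refine (mul_le_mul' hS (ciSup_le' hcard)).trans ?_
      exact (mul_eq_self hκ).le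
    let q : Φ → S := fun ψ => if hψ : ∃ s, ψ ∈ (e s : Set Φ) then
      (if ψ = φ hψ.choose then hψ.choose else p hψ.choose ψ) else Classical.arbitrary S
    have hq : ∀ s, ∀ ψ ∈ (e s : Set Φ), q ψ = if ψ = φ s then s else p s ψ := by
      intro s ψ hs
      have hψ : ∃ s, ψ ∈ (e s : Set Φ) := ⟨s, hs⟩
      have hse : hψ.choose = s := huniq _ _ ψ hψ.choose_spec hs
      simp only [q, dif_pos hψ, hse]
    obtain ⟨ξ, hξ, hV'⟩ := h V (Set.disjoint_iUnion_left.2 hdis) hV q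
    have key : ∀ ψ ∈ (e (g ξ) : Set Φ), f ψ ξ = if ψ = φ (g ξ) then g ξ else p (g ξ) ψ :=
      fun ψ hψ => (hV' ψ (Set.mem_iUnion.2 ⟨_, hψ⟩)).trans (hq _ ψ hψ)
    refine hp (g ξ) ξ hξ ?_ fun ψ hψ hne => ?_
    · simpa using key _ (hφ (g ξ))
    · simpa [hne] using key ψ hψ
  refine ⟨⋃₀ F, ?_, ?_⟩
  · rw [Set.sUnion_eq_iUnion]
    refine (mk_iUnion_le _).trans ?_
    refine (mul_le_mul' (hFS.trans hS) (ciSup_le' fun T => (hF.prop.1 _ T.2).2.1)).trans ?_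
    exact (mul_eq_self hκ).le
  · intro U' hU' φ hφ V hV hVκ p
    by_contra! hcon
    have hT : Bad (insert φ V) := by
      refine ⟨?_, ?_, φ, Set.mem_insert _ _, p, ?_⟩
      · rw [Set.disjoint_insert_left]
        exact ⟨fun h' => hφ (hU' (Or.inl h')),
          hV.mono_right ((Set.subset_union_left.trans hU').trans (Set.subset_insert _ _))⟩
      · exact (mk_insert_le).trans (add_le_of_le hκ hVκ (one_le_aleph0.trans hκ))
      · intro ξ hξ hg hall
        obtain ⟨ψ, hψ, hne⟩ := hcon ξ ⟨hξ, hg⟩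
        refine hne (hall ψ (Or.inr hψ) ?_)
        rintro rfl
        exact Set.disjoint_left.1 hV hψ (Set.mem_insert _ _)
    have hmem : insert φ V ∈ F := by
      have hsub : insert (insert φ V) F ⊆ F := by
        refine hF.le_of_ge ⟨?_, ?_⟩ (Set.subset_insert _ _)
        · rintro T (rfl | hT')
          exacts [hT, hF.prop.1 _ hT']
        · refine hF.prop.2.insert fun T hTF _ => ?_
          have hTU : T ⊆ U' :=
            (Set.subset_sUnion_of_mem hTF).trans (Set.subset_union_right.trans hU')
          simp only [id, Set.disjoint_insert_left]
          exact ⟨fun h' => hφ (hTU h'), hV.mono_right (hTU.trans (Set.subset_insert _ _))⟩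
      exact hsub (Set.mem_insert _ _)
    exact hφ (hU' (Or.inr ⟨_, hmem, Set.mem_insert _ _⟩))

open Cardinal in
/-- A Hausdorff-type independent family: `2 ^ 2 ^ κ` functions on a set of size `2 ^ κ`. -/
theorem exists_indepOff (K S : Type u) [Infinite K] [Nonempty S] :
    ∃ f : Set (Set K) → ((K → Set K) × (K → Set K × S)) → S,
      IndepOff f #K ∅ Set.univ := by
  classical
  refine ⟨fun φ ξ => if h : ∃ k, (ξ.2 k).1 = ξ.1 ⁻¹' φ then (ξ.2 h.choose).2
    else Classical.arbitrary S, ?_⟩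
  intro V _ hV p
  rcases V.eq_empty_or_nonempty with rfl | ⟨φ₀, hφ₀⟩
  · exact ⟨⟨fun _ => ∅, fun _ => (∅, Classical.arbitrary S)⟩, trivial, by simp⟩
  have : Nonempty V := ⟨⟨φ₀, hφ₀⟩⟩
  have hVV : #(V × V) ≤ #K := by
    rw [mk_prod, lift_id]
    exact (mul_le_mul' hV hV).trans (mul_eq_self (aleph0_le_mk K)).le
  obtain ⟨e, he⟩ : ∃ e : K → V, Function.Surjective e := by
    obtain ⟨i⟩ := Cardinal.le_def V K |>.1 hV
    exact ⟨Function.invFun i, Function.invFun_surjective i.injective⟩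
  obtain ⟨d, hd⟩ : ∃ d : K → V × V, Function.Surjective d := by
    obtain ⟨i⟩ := Cardinal.le_def (V × V) K |>.1 hVV
    exact ⟨Function.invFun i, Function.invFun_surjective i.injective⟩
  have hsep : ∀ k, ∃ l : Set K, (d k).1 ≠ (d k).2 →
      ¬ (l ∈ ((d k).1 : Set (Set K)) ↔ l ∈ ((d k).2 : Set (Set K))) := by
    intro k
    by_contra! hcon
    exact (hcon ∅).1 (Subtype.ext (Set.ext fun l => (hcon l).2))
  choose s hs using hsep
  have hinj : ∀ φ ψ : V, s ⁻¹' (φ : Set (Set K)) = s ⁻¹' (ψ : Set (Set K)) → φ = ψ := by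
    intro φ ψ h
    by_contra hne
    obtain ⟨k, hk⟩ := hd (φ, ψ)
    refine hs k (by rw [hk]; exact hne) ?_
    rw [hk]
    exact Set.ext_iff.1 h k
  refine ⟨⟨s, fun k => (s ⁻¹' (e k : Set (Set K)), p (e k))⟩, trivial, fun φ hφ => ?_⟩
  obtain ⟨k, hk⟩ := he ⟨φ, hφ⟩
  have hex : ∃ k, s ⁻¹' (e k : Set (Set K)) = s ⁻¹' φ := ⟨k, by rw [hk]⟩
  have := hinj (e hex.choose) ⟨φ, hφ⟩ hex.choose_spec
  simp only [dif_pos hex, this]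

/-- Transfinite construction of a monotone family, one requirement `T w` at a time. -/
theorem exists_monotone_of_step {P W : Type u} [Preorder P] [Nonempty P] [LinearOrder W]
    [WellFoundedLT W] (T : W → P → Prop)
    (step : ∀ (w : W) (s : Set.Iio w → P), Monotone s → (∀ v : Set.Iio w, T v (s v)) →
      ∃ q, T w q ∧ ∀ v, s v ≤ q) :
    ∃ s : W → P, Monotone s ∧ ∀ w, T w (s w) := by
  classical
  let F : (w : W) → ((v : W) → v < w → P) → P := fun w s =>
    if h : ∃ q, T w q ∧ ∀ v hv, s v hv ≤ q then h.choose else Classical.arbitrary P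
  let s : W → P := (wellFounded_lt (α := W)).fix F
  have hs : ∀ w, s w = F w fun v _ => s v := fun w => WellFounded.fix_eq _ F w
  have key : ∀ w, T w (s w) ∧ ∀ v < w, s v ≤ s w := by
    intro w
    induction w using WellFoundedLT.induction with
    | ind w ih =>
      have hex : ∃ q, T w q ∧ ∀ v (_ : v < w), s v ≤ q := by
        obtain ⟨q, hq, hle⟩ := step w (fun v : Set.Iio w => s v) (fun v v' hvv' => by
          rcases hvv'.eq_or_lt with h | h
          · rw [h]
          · exact (ih v' v'.2).2 v h) (fun v => (ih v v.2).1)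
        exact ⟨q, hq, fun v hv => hle ⟨v, hv⟩⟩
      rw [hs w]
      simp only [F, dif_pos hex]
      exact hex.choose_spec
  refine ⟨s, fun v w hvw => ?_, fun w => (key w).1⟩
  rcases hvw.eq_or_lt with h | h
  · rw [h]
  · exact (key w).2 v h

/-- `F` depends on finitely many coordinates, all of them in `M`. -/
def Finitary {ι X β : Type*} (M : Set ι) (F : (ι → X) → β) : Prop :=
  ∃ Q : Finset ι, ↑Q ⊆ M ∧ DependsOn F (Q : Set ι)

theorem Finitary.mono {ι X β : Type*} {M N : Set ι} {F : (ι → X) → β} (h : Finitary M F)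
    (hMN : M ⊆ N) : Finitary N F := by
  obtain ⟨Q, hQ, hF⟩ := h
  exact ⟨Q, hQ.trans hMN, hF⟩

open Cardinal in
theorem mk_finitary_le {ι X β : Type u} [Nonempty X] {c : Cardinal.{u}} (hc : ℵ₀ ≤ c)
    {M : Set ι} (hM : #M ≤ c) (hX : #((ℕ → X) → β) ≤ c) :
    #{F : (ι → X) → β | Finitary M F} ≤ c := by
  classical
  have hsub : {F : (ι → X) → β | Finitary M F} ⊆
      ⋃ Q : Finset M, {F : (ι → X) → β | DependsOn F ((↑) '' (Q : Set M) : Set ι)} := by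
    rintro F ⟨Q, hQ, hF⟩
    refine Set.mem_iUnion.2 ⟨Q.subtype (· ∈ M), ?_⟩
    change DependsOn F _
    convert hF using 1
    ext x
    simpa using fun hx => hQ hx
  refine (mk_le_mk_of_subset hsub).trans ((mk_iUnion_le _).trans ?_)
  have h1 : #(Finset M) ≤ c := by
    rcases finite_or_infinite M with h | h
    · exact (lt_aleph0_of_finite _).le.trans hc
    · rwa [mk_finset_of_infinite]
  refine (mul_le_mul' h1 (ciSup_le' fun Q => le_trans ?_ hX)).trans (mul_eq_self hc).le
  let Q' : Set ι := (↑) '' (Q : Set M)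
  have hQ' : Q'.Countable := (Q.finite_toSet.image _).countable
  obtain ⟨e, he⟩ := Set.countable_iff_exists_injOn.1 hQ'
  refine mk_le_of_injective
    (f := fun F : {F : (ι → X) → β | DependsOn F Q'} => fun y : ℕ → X => F.1 fun m => y (e m)) ?_
  rintro ⟨F, hF⟩ ⟨F', hF'⟩ h
  refine Subtype.ext (funext fun x => ?_)
  let y : ℕ → X := fun n => if h : ∃ m ∈ Q', e m = n then x h.choose else Classical.arbitrary X
  have hy : ∀ m ∈ Q', x m = y (e m) := by
    intro m hm
    have hex : ∃ m' ∈ Q', e m' = e m := ⟨m, hm, rfl⟩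
    simp only [y, dif_pos hex]
    rw [he hex.choose_spec.1 hm hex.choose_spec.2]
  have := congrFun h y
  exact (hF hy).trans (this.trans (hF' hy).symm)

/-- If `u` and `v` agree on the finitely many relevant existential statements, any `a` over `u` is
matched by some `b` over `v`. -/
theorem exists_matching {I J X Y : Type*} [Nonempty X] (D : Ultrafilter I) (E : Ultrafilter J)
    (u : I → Y) (v : J → Y) (𝓣 : Finset (Y → Set X))
    (H : ∀ σ ⊆ 𝓣, (∀ᶠ i in (D : Filter I), ∃ y, ∀ T ∈ 𝓣, y ∈ T (u i) ↔ T ∈ σ) →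
      ∀ᶠ j in (E : Filter J), ∃ y, ∀ T ∈ 𝓣, y ∈ T (v j) ↔ T ∈ σ) (a : I → X) :
    ∃ b : J → X, ∀ T ∈ 𝓣, (∀ᶠ i in (D : Filter I), a i ∈ T (u i)) ↔
      ∀ᶠ j in (E : Filter J), b j ∈ T (v j) := by
  classical
  let σ := 𝓣.filter fun T => ∀ᶠ i in (D : Filter I), a i ∈ T (u i)
  have h1 : ∀ᶠ i in (D : Filter I), ∀ T ∈ 𝓣, a i ∈ T (u i) ↔ T ∈ σ := by
    rw [Filter.eventually_all_finset]
    intro T hT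
    by_cases h : ∀ᶠ i in (D : Filter I), a i ∈ T (u i)
    · exact h.mono fun i hi => by simp [σ, hT, h, hi]
    · exact (Ultrafilter.eventually_not.2 h).mono fun i hi => by simp [σ, h, hi]
  have h2 := H σ (Finset.filter_subset _ _) (h1.mono fun i hi => ⟨_, hi⟩)
  obtain ⟨b, hb⟩ := Filter.Eventually.choice h2
  refine ⟨b, fun T hT => ?_⟩
  by_cases h : ∀ᶠ i in (D : Filter I), a i ∈ T (u i)
  · exact iff_of_true h (hb.mono fun j hj => (hj T hT).2 (by simp [σ, hT, h]))
  · refine iff_of_false h (Ultrafilter.eventually_not.1 (hb.mono fun j hj => ?_))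
    rw [hj T hT]
    simp [σ, h]

/-- The points at which the left and right families of pairs give the same truth value to `R`. -/
def agreeSet {I J X Λ : Type*} (D : Ultrafilter I) (E : Ultrafilter J)
    (R : ((Λ → I → X) × (Λ → J → X) → X) → Prop) : Set Λ :=
  {ξ | (∀ᶠ i in (D : Filter I), R fun m => m.1 ξ i) ↔ ∀ᶠ j in (E : Filter J), R fun m => m.2 ξ j}

/-- The relation on the old coordinates asserting that some `y` has exactly the properties `σ`
among those in `𝓣`. -/
def existsPattern {Y X : Type*} (𝓣 σ : Finset (Y → Set X)) (x : Y) : Prop :=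
  ∃ y, ∀ T ∈ 𝓣, y ∈ T x ↔ T ∈ σ

theorem Finitary.existsPattern {ι X : Type*} {M : Set ι} {𝓣 σ : Finset ((ι → X) → Set X)}
    (h : ∀ T ∈ 𝓣, Finitary M T) : Finitary M (existsPattern 𝓣 σ) := by
  classical
  choose! Q hQ hT using h
  refine ⟨𝓣.biUnion Q, by simpa using hQ, fun x y hxy => ?_⟩
  have : ∀ T ∈ 𝓣, T x = T y := fun T hT' => hT T hT' fun m hm =>
    hxy m (by simpa using ⟨T, hT', hm⟩)
  simp only [_root_.existsPattern, eq_iff_iff]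
  exact exists_congr fun z => forall₂_congr fun T hT' => by rw [this T hT']

theorem Finitary.update {ι X : Type*} [DecidableEq ι] {M : Set ι} {m₀ : ι} {R : (ι → X) → Prop}
    (h : Finitary (insert m₀ M) R) :
    Finitary M fun x => {y | R (Function.update x m₀ y)} := by
  obtain ⟨Q, hQ, hR⟩ := h
  refine ⟨Q.erase m₀, ?_, fun x x' hx => Set.ext fun y => ?_⟩
  · intro m hm
    rw [Finset.mem_coe, Finset.mem_erase] at hm
    exact (hQ hm.2).resolve_left hm.1
  · refine iff_of_eq (hR fun m hm => ?_)
    by_cases hmm : m = m₀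
    · subst hmm; simp
    · simpa [hmm] using hx m (by simpa [hmm] using hm)

/-- A stage of the construction: the pairs matched so far are given by `M`, and all finite
requirements on them can be met independently of the functions with index outside `U`. -/
def StageConsistent {I J X Λ Φ S : Type u} (D : Ultrafilter I) (E : Ultrafilter J)
    (f : Φ → Λ → S) (κ : Cardinal.{u}) (U : Set Φ) (M : Set ((Λ → I → X) × (Λ → J → X))) : Prop :=
  ∀ 𝓡 : Set (((Λ → I → X) × (Λ → J → X) → X) → Prop), 𝓡.Finite → (∀ R ∈ 𝓡, Finitary M R) →
    IndepOff f κ U (⋂ R ∈ 𝓡, agreeSet D E R)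

open Cardinal in
/-- One more pair `mk (f φ)` can be added to a consistent stage, provided that the finite
requirements on it are satisfied as soon as `f φ` takes suitable values. -/
theorem StageConsistent.exists_insert {I J X Λ Φ S : Type u} [Nonempty X] [Nonempty S]
    {D : Ultrafilter I} {E : Ultrafilter J} {f : Φ → Λ → S} {κ c : Cardinal.{u}} (hκ : ℵ₀ ≤ κ)
    (hS : #S ≤ κ) (hX : #((ℕ → X) → Set X) ≤ κ) (hκc : κ ≤ c) (hcΦ : c < #Φ)
    {U : Set Φ} {M : Set ((Λ → I → X) × (Λ → J → X))} (hU : #U ≤ c) (hM : #M ≤ c)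
    (h : StageConsistent D E f κ U M) (pair : (Λ → S) → (Λ → I → X) × (Λ → J → X))
    (hpair : ∀ (𝓣 : Finset (((Λ → I → X) × (Λ → J → X) → X) → Set X)) (ξ : Λ),
      (∀ σ ⊆ 𝓣, ξ ∈ agreeSet D E (existsPattern 𝓣 σ)) → ∃ s : S, ∀ k : Λ → S, k ξ = s →
        ∀ T ∈ 𝓣, (∀ᶠ i in (D : Filter I), (pair k).1 ξ i ∈ T fun m => m.1 ξ i) ↔
          ∀ᶠ j in (E : Filter J), (pair k).2 ξ j ∈ T fun m => m.2 ξ j) :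
    ∃ (k : Λ → S) (U' : Set Φ), U ⊆ U' ∧ #U' ≤ c ∧ #(insert (pair k) M : Set _) ≤ c ∧
      StageConsistent D E f κ U' (insert (pair k) M) := by
  classical
  have hc : ℵ₀ ≤ c := hκ.trans hκc
  let TT : Set (((Λ → I → X) × (Λ → J → X) → X) → Set X) := {T | Finitary M T}
  have hTT : #TT ≤ c := mk_finitary_le hc hM (hX.trans hκc)
  have hfin : #(Finset TT) ≤ c := by
    rcases finite_or_infinite TT with h | h
    · exact (lt_aleph0_of_finite _).le.trans hc
    · rwa [mk_finset_of_infinite]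
  let baseSet : Finset TT → Finset (((Λ → I → X) × (Λ → J → X) → X) → Set X) :=
    fun t => t.map (Function.Embedding.subtype _)
  have hbaseSet : ∀ t, ∀ T ∈ baseSet t, Finitary M T := by
    intro t T hT
    obtain ⟨T', -, rfl⟩ := Finset.mem_map.1 hT
    exact T'.2
  let Z : Finset TT → Set Λ := fun t =>
    ⋂ R ∈ existsPattern (baseSet t) '' {σ | σ ⊆ baseSet t}, agreeSet D E R
  have hZ : ∀ t, IndepOff f κ U (Z t) := by
    intro t
    refine h _ (Set.Finite.image _ ?_) ?_
    · exact ((baseSet t).powerset.finite_toSet).subset fun σ hσ => by simpa using hσ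
    · rintro _ ⟨σ, -, rfl⟩
      exact Finitary.existsPattern (hbaseSet t)
  have hg : ∀ t ξ, ∃ s : S, ξ ∈ Z t → ∀ k : Λ → S, k ξ = s →
        ∀ T ∈ baseSet t, (∀ᶠ i in (D : Filter I), (pair k).1 ξ i ∈ T fun m => m.1 ξ i) ↔
          ∀ᶠ j in (E : Filter J), (pair k).2 ξ j ∈ T fun m => m.2 ξ j := by
    intro t ξ
    by_cases hξ : ξ ∈ Z t
    · obtain ⟨s, hs⟩ := hpair (baseSet t) ξ fun σ hσ =>
        Set.mem_iInter₂.1 hξ _ (Set.mem_image_of_mem _ hσ)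
      exact ⟨s, fun _ => hs⟩
    · exact ⟨Classical.arbitrary S, fun h => absurd h hξ⟩
  choose g hg using hg
  choose B hB hBind using fun t => (hZ t).exists_avoid hκ hS (g t)
  let U₁ : Set Φ := U ∪ ⋃ t, B t
  have hU₁ : #U₁ ≤ c := by
    refine (mk_union_le _ _).trans (add_le_of_le hc hU ?_)
    refine (mk_iUnion_le _).trans ?_
    exact (mul_le_mul' hfin (ciSup_le' fun t => (hB t).trans hκc)).trans (mul_eq_self hc).le
  obtain ⟨φ, hφ⟩ : ∃ φ, φ ∉ U₁ := by
    by_contra! hall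
    rw [Set.eq_univ_of_forall hall, mk_univ] at hU₁
    exact hU₁.not_gt hcΦ
  refine ⟨f φ, insert φ U₁, Set.subset_union_left.trans (Set.subset_insert _ _),
    mk_insert_le.trans (add_le_of_le hc hU₁ (one_le_aleph0.trans hc)),
    mk_insert_le.trans (add_le_of_le hc hM (one_le_aleph0.trans hc)), ?_⟩
  intro 𝓡 h𝓡 hR
  let tr : (((Λ → I → X) × (Λ → J → X) → X) → Prop) → (((Λ → I → X) × (Λ → J → X) → X) → Set X) :=
    fun R x => {y | R (Function.update x (pair (f φ)) y)}
  have htr : ∀ R ∈ 𝓡, tr R ∈ TT := fun R hR' => (hR R hR').update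
  let t : Finset TT := (h𝓡.toFinset.image tr).subtype (· ∈ TT)
  have ht : ∀ R ∈ 𝓡, tr R ∈ baseSet t := by
    intro R hR'
    refine Finset.mem_map.2 ⟨⟨tr R, htr R hR'⟩, ?_, rfl⟩
    simp only [t, Finset.mem_subtype, Finset.mem_image, Set.Finite.mem_toFinset]
    exact ⟨R, hR', rfl⟩
  refine (hBind t U₁ (Set.union_subset_union_right _ (Set.subset_iUnion _ t)) φ hφ).mono
    subset_rfl ?_
  rintro ξ ⟨hξ, hφξ⟩
  refine Set.mem_iInter₂.2 fun R hR' => ?_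
  have := hg t ξ hξ (f φ) hφξ (tr R) (ht R hR')
  simpa only [tr, Set.mem_ofPred_eq, agreeSet,
    Function.update_eq_self (pair (f φ)) (fun m : (Λ → I → X) × (Λ → J → X) => m.1 ξ _),
    Function.update_eq_self (pair (f φ)) (fun m : (Λ → I → X) × (Λ → J → X) => m.2 ξ _)]
    using this

theorem StageConsistent.empty {I J X Λ Φ S : Type u} [Nonempty X]
    (D : Ultrafilter I) (E : Ultrafilter J)
    {f : Φ → Λ → S} {κ : Cardinal.{u}} (hf : IndepOff f κ ∅ Set.univ) :
    StageConsistent (X := X) D E f κ ∅ ∅ := by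
  intro 𝓡 _ hR
  refine hf.mono subset_rfl fun ξ _ => Set.mem_iInter₂.2 fun R hR' => ?_
  obtain ⟨Q, hQ, hdep⟩ := hR R hR'
  have hconst : ∀ x, R x = R fun _ => Classical.arbitrary X :=
    fun x => hdep fun m hm => (hQ hm).elim
  simp only [agreeSet, Set.mem_ofPred_eq, hconst fun m => m.1 ξ _, hconst fun m => m.2 ξ _]
  simp

theorem exists_finitary_of_iUnion {ι X W : Type*} {M : W → Set ι} [Nonempty W]
    (hM : Directed (· ⊆ ·) M) (𝓡 : Set ((ι → X) → Prop)) (h𝓡 : 𝓡.Finite)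
    (hR : ∀ R ∈ 𝓡, Finitary (⋃ w, M w) R) : ∃ w, ∀ R ∈ 𝓡, Finitary (M w) R := by
  classical
  choose! Q hQ hdep using hR
  have hsub : ((h𝓡.toFinset.biUnion Q : Finset ι) : Set ι) ⊆ ⋃ w, M w := by
    simpa using hQ
  obtain ⟨w, hw⟩ := hM.exists_mem_subset_of_finset_subset_biUnion hsub
  refine ⟨w, fun R hR => ⟨Q R, subset_trans ?_ hw, hdep R hR⟩⟩
  exact Finset.coe_subset.2 (Finset.subset_biUnion_of_mem Q (by simpa using hR))

theorem StageConsistent.iUnion {I J X Λ Φ S W : Type u} [Nonempty W]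
    {D : Ultrafilter I} {E : Ultrafilter J} {f : Φ → Λ → S} {κ : Cardinal.{u}}
    {U : W → Set Φ} {M : W → Set ((Λ → I → X) × (Λ → J → X))} (hM : Directed (· ⊆ ·) M)
    (h : ∀ w, StageConsistent D E f κ (U w) (M w)) :
    StageConsistent D E f κ (⋃ w, U w) (⋃ w, M w) := by
  intro 𝓡 h𝓡 hR
  obtain ⟨w, hw⟩ := exists_finitary_of_iUnion hM 𝓡 h𝓡 hR
  exact (h w 𝓡 h𝓡 hw).mono (Set.subset_iUnion _ w) subset_rfl

open Cardinal in
theorem mk_fun_le_two_power_two_power {K Λ A S : Type u} [Infinite K] (hΛ : #Λ ≤ 2 ^ #K)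
    (hA : #A ≤ #S) (hS : #S ≤ #K) : #(Λ → A) ≤ 2 ^ (2 : Cardinal.{u}) ^ #K := by
  have hK := aleph0_le_mk K
  have h2 : #K ≤ 2 ^ #K := (cantor _).le
  have h1 : (1 : Cardinal.{u}) ≤ 2 ^ #K := one_le_aleph0.trans (hK.trans h2)
  calc #(Λ → A) = #A ^ #Λ := by simp
    _ ≤ (2 ^ #K) ^ #Λ := power_le_power_right ((hA.trans hS).trans h2)
    _ ≤ (2 ^ #K) ^ ((2 : Cardinal.{u}) ^ #K) := power_le_power_left (zero_lt_one.trans_le h1).ne' hΛ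
    _ = 2 ^ (2 : Cardinal.{u}) ^ #K := by
      rw [← power_mul, mul_eq_right (hK.trans h2) h2 (aleph0_pos.trans_le hK).ne']

open Cardinal in
theorem mk_indep_domain_le {K S : Type u} [Infinite K] (hS : #S ≤ #K) :
    #((K → Set K) × (K → Set K × S)) ≤ 2 ^ #K := by
  have hK := aleph0_le_mk K
  have h2 : #K ≤ 2 ^ #K := (cantor _).le
  have hpow : ((2 : Cardinal.{u}) ^ #K) ^ #K = 2 ^ #K := by
    rw [← power_mul, mul_eq_self hK]
  have h3 : #(Set K × S) ≤ 2 ^ #K := by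
    rw [mk_prod, lift_id, lift_id, mk_set]
    exact (mul_le_mul' le_rfl (hS.trans h2)).trans (mul_eq_self (hK.trans h2)).le
  calc #((K → Set K) × (K → Set K × S))
      = #(Set K) ^ #K * #(Set K × S) ^ #K := by simp
    _ ≤ (2 ^ #K) ^ #K * (2 ^ #K) ^ #K := by
      rw [mk_set]
      exact mul_le_mul' le_rfl (power_le_power_right h3)
    _ = 2 ^ #K := by rw [hpow, mul_eq_self (hK.trans h2)]

open Cardinal in
/-- **Keisler–Shelah for iterated ultrapowers of a set with all its finitary relations.** There are
an ultrafilter `G` and a total correspondence between `Λ → I → X` and `Λ → J → X` under which all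
finitary relations have the same truth value in the two iterated ultrapowers. -/
theorem exists_ultrafilter_correspondence {X I J : Type u} [Nonempty X] (D : Ultrafilter I)
    (E : Ultrafilter J) :
    ∃ (Λ : Type u) (G : Ultrafilter Λ) (M : Set ((Λ → I → X) × (Λ → J → X))),
      (∀ a, ∃ b, (a, b) ∈ M) ∧ (∀ b, ∃ a, (a, b) ∈ M) ∧ ∀ R, Finitary M R →
        ((∀ᶠ ξ in (G : Filter Λ), ∀ᶠ i in (D : Filter I), R fun m => m.1 ξ i) ↔
          ∀ᶠ ξ in (G : Filter Λ), ∀ᶠ j in (E : Filter J), R fun m => m.2 ξ j) := by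
  classical
  let S := (I → X) × (J → X)
  let K : Type u := (S ⊕ ((ℕ → X) → Set X)) ⊕ ULift.{u} ℕ
  have hS : #S ≤ #K := mk_le_of_injective (Sum.inl_injective.comp Sum.inl_injective)
  have hX : #((ℕ → X) → Set X) ≤ #K :=
    mk_le_of_injective (Sum.inl_injective.comp Sum.inr_injective)
  have hK : ℵ₀ ≤ #K := aleph0_le_mk K
  obtain ⟨f, hf⟩ := exists_indepOff K S
  let Λ := (K → Set K) × (K → Set K × S)
  let Φ := Set (Set K)
  have hΦ : #Φ = 2 ^ (2 : Cardinal.{u}) ^ #K := by simp only [Φ, mk_set]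
  have hKΦ : #K < #Φ := by
    rw [hΦ]
    exact (cantor _).trans (cantor _)
  have hΛ : #Λ ≤ 2 ^ #K := mk_indep_domain_le hS
  let W : Type u := (#Φ).ord.ToType
  have hIio : ∀ w : W, #(Set.Iio w) < #Φ := fun w =>
    (mk_Iio_lt w (by simp [W])).trans_eq (mk_ord_toType _)
  obtain ⟨task, htask⟩ : ∃ task : W → (Λ → I → X) ⊕ (Λ → J → X), Function.Surjective task := by
    have hle : #((Λ → I → X) ⊕ (Λ → J → X)) ≤ #W := by
      rw [mk_ord_toType, mk_sum, lift_id, lift_id]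
      refine add_le_of_le (hK.trans hKΦ.le) ?_ ?_ <;> rw [hΦ]
      · exact mk_fun_le_two_power_two_power hΛ
          (mk_le_of_surjective (f := Prod.fst) (Prod.fst_surjective (α := I → X) (β := J → X))) hS
      · exact mk_fun_le_two_power_two_power hΛ
          (mk_le_of_surjective (f := Prod.snd) (Prod.snd_surjective (α := I → X) (β := J → X))) hS
    obtain ⟨e⟩ := Cardinal.le_def _ _ |>.1 hle
    exact ⟨Function.invFun e, Function.invFun_surjective e.injective⟩
  let c : W → Cardinal.{u} := fun w => max #K #(Set.Iio w)
  have hcΦ : ∀ w, c w < #Φ := fun w => max_lt hKΦ (hIio w)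
  have hKc : ∀ w, #K ≤ c w := fun w => le_max_left _ _
  have hc : ∀ w, ℵ₀ ≤ c w := fun w => hK.trans (hKc w)
  let Done : (Λ → I → X) ⊕ (Λ → J → X) → Set ((Λ → I → X) × (Λ → J → X)) → Prop := fun t M =>
    t.elim (fun a => ∃ b, (a, b) ∈ M) (fun b => ∃ a, (a, b) ∈ M)
  obtain ⟨s, hmono, hs⟩ := exists_monotone_of_step
    (P := Set Φ × Set ((Λ → I → X) × (Λ → J → X))) (W := W)
    (fun w p => #p.1 ≤ c w ∧ #p.2 ≤ c w ∧ StageConsistent D E f #K p.1 p.2 ∧ Done (task w) p.2) (by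
    intro w s hmono hs
    let U : Option (Set.Iio w) → Set Φ := fun o => o.elim ∅ fun v => (s v).1
    let M : Option (Set.Iio w) → Set ((Λ → I → X) × (Λ → J → X)) :=
      fun o => o.elim ∅ fun v => (s v).2
    have hcle : ∀ v : Set.Iio w, c v ≤ c w := fun v =>
      max_le_max le_rfl (mk_le_mk_of_subset (Set.Iio_subset_Iio (le_of_lt v.2)))
    have hO : #(Option (Set.Iio w)) ≤ c w := by
      rw [mk_option]
      exact add_le_of_le (hc w) (le_max_right _ _) (one_le_aleph0.trans (hc w))
    have hU : #(⋃ o, U o : Set Φ) ≤ c w := by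
      refine (mk_iUnion_le _).trans ((mul_le_mul' hO (ciSup_le' ?_)).trans (mul_eq_self (hc w)).le)
      rintro (_ | v)
      · simp [U]
      · exact (hs v).1.trans (hcle v)
    have hM : #(⋃ o, M o : Set _) ≤ c w := by
      refine (mk_iUnion_le _).trans ((mul_le_mul' hO (ciSup_le' ?_)).trans (mul_eq_self (hc w)).le)
      rintro (_ | v)
      · simp [M]
      · exact (hs v).2.1.trans (hcle v)
    have hdir : Directed (· ⊆ ·) M := by
      rintro (_ | v) (_ | v')
      · exact ⟨none, by simp [M], by simp [M]⟩
      · exact ⟨some v', by simp [M], subset_rfl⟩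
      · exact ⟨some v, subset_rfl, by simp [M]⟩
      · rcases le_total v v' with h | h
        · exact ⟨some v', (hmono h).2, subset_rfl⟩
        · exact ⟨some v, subset_rfl, (hmono h).2⟩
    have hcons : StageConsistent D E f #K (⋃ o, U o) (⋃ o, M o) := by
      refine StageConsistent.iUnion hdir ?_
      rintro (_ | v)
      · exact StageConsistent.empty D E hf
      · exact (hs v).2.2.1
    obtain ⟨k, U', hUU', hU', hM', hcons', hdone⟩ :
        ∃ (m : (Λ → I → X) × (Λ → J → X)) (U' : Set Φ), (⋃ o, U o) ⊆ U' ∧ #U' ≤ c w ∧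
          #(insert m (⋃ o, M o) : Set _) ≤ c w ∧
          StageConsistent D E f #K U' (insert m (⋃ o, M o)) ∧
          Done (task w) (insert m (⋃ o, M o)) := by
      rcases htw : task w with a | b
      · obtain ⟨k, U', h1, h2, h3, h4⟩ := hcons.exists_insert hK hS hX (hKc w) (hcΦ w) hU hM
          (fun k => (a, fun ξ => (k ξ).2)) (by
            intro 𝓣 ξ hξ
            obtain ⟨b, hb⟩ := exists_matching D E _ _ 𝓣 (fun σ hσ => (hξ σ hσ).1) (a ξ)
            refine ⟨(Classical.arbitrary _, b), fun k hk T hT => ?_⟩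
            simpa only [hk] using hb T hT)
        exact ⟨_, U', h1, h2, h3, h4, _, Set.mem_insert _ _⟩
      · obtain ⟨k, U', h1, h2, h3, h4⟩ := hcons.exists_insert hK hS hX (hKc w) (hcΦ w) hU hM
          (fun k => (fun ξ => (k ξ).1, b)) (by
            intro 𝓣 ξ hξ
            obtain ⟨a, ha⟩ := exists_matching E D _ _ 𝓣 (fun σ hσ => (hξ σ hσ).2) (b ξ)
            refine ⟨(a, Classical.arbitrary _), fun k hk T hT => ?_⟩
            simpa only [hk] using (ha T hT).symm)
        exact ⟨_, U', h1, h2, h3, h4, _, Set.mem_insert _ _⟩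
    refine ⟨(U', insert k (⋃ o, M o)), ⟨hU', hM', hcons', hdone⟩, fun v => ⟨?_, ?_⟩⟩
    · exact (Set.subset_iUnion U (some v)).trans hUU'
    · exact (Set.subset_iUnion M (some v)).trans (Set.subset_insert _ _))
  have : Nonempty W := ⟨(htask (Sum.inl fun _ _ => Classical.arbitrary X)).choose⟩
  let M : Set ((Λ → I → X) × (Λ → J → X)) := ⋃ w, (s w).2
  have hcons : StageConsistent D E f #K (⋃ w, (s w).1) M :=
    StageConsistent.iUnion (Monotone.directed_le fun v w h => (hmono h).2) fun w => (hs w).2.2.1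
  let l : Filter Λ := Filter.generate {A | ∃ R, Finitary M R ∧ agreeSet D E R = A}
  have hne : l.NeBot := by
    rw [Filter.generate_neBot_iff]
    intro t ht htfin
    choose! R hR hRA using ht
    obtain ⟨ξ, hξ, -⟩ := hcons (R '' t) (htfin.image _) (by rintro _ ⟨A, hA, rfl⟩; exact hR hA)
      ∅ (Set.empty_disjoint _) (by simp) fun _ => Classical.arbitrary S
    refine ⟨ξ, fun A hA => ?_⟩
    rw [← hRA hA]
    exact Set.mem_iInter₂.1 hξ _ (Set.mem_image_of_mem _ hA)
  refine ⟨Λ, Ultrafilter.of l, M, fun a => ?_, fun b => ?_, fun R hR => ?_⟩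
  · obtain ⟨w, hw⟩ := htask (Sum.inl a)
    have := (hs w).2.2.2
    rw [hw] at this
    obtain ⟨b, hb⟩ := this
    exact ⟨b, Set.mem_iUnion.2 ⟨w, hb⟩⟩
  · obtain ⟨w, hw⟩ := htask (Sum.inr b)
    have := (hs w).2.2.2
    rw [hw] at this
    obtain ⟨a, ha⟩ := this
    exact ⟨a, Set.mem_iUnion.2 ⟨w, ha⟩⟩
  · refine Filter.eventually_congr ?_
    exact Ultrafilter.of_le l (Filter.mem_generate_of_mem ⟨R, hR, rfl⟩)

/-- A presentation of the normed space `V` as the space of functions `P → X` bounded along `l`,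
modulo those tending to `0`, with norm the limit of norms. -/
structure GermPresentation {P : Type*} (l : Filter P) (X V : Type*) [NormedAddCommGroup X]
    [NormedSpace ℝ X] [NormedAddCommGroup V] [NormedSpace ℝ V] where
  rel : Submodule ℝ ((P → X) × V)
  exists_fun : ∀ x, ∃ a, (a, x) ∈ rel
  exists_vec : ∀ a C, (∀ᶠ p in l, ‖a p‖ ≤ C) → ∃ x, (a, x) ∈ rel
  eventually_lt : ∀ {a x r}, (a, x) ∈ rel → ‖x‖ < r → ∀ᶠ p in l, ‖a p‖ < r
  norm_le : ∀ {a x r}, (a, x) ∈ rel → 0 ≤ r → (∀ᶠ p in l, ‖a p‖ ≤ r) → ‖x‖ ≤ r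

theorem GermPresentation.congr {P X V : Type*} {l : Filter P} [NormedAddCommGroup X]
    [NormedSpace ℝ X] [NormedAddCommGroup V] [NormedSpace ℝ V] (ρ : GermPresentation l X V)
    {a b : P → X} {x : V} (h : (a, x) ∈ ρ.rel) (hab : a =ᶠ[l] b) : (b, x) ∈ ρ.rel := by
  have h0 : ∀ᶠ p in l, ‖(b - a) p‖ ≤ 0 := hab.mono fun p hp => by simp [hp]
  obtain ⟨y, hy⟩ := ρ.exists_vec (b - a) 0 h0
  have hy0 : y = 0 := norm_le_zero_iff.1 (ρ.norm_le hy le_rfl h0)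
  simpa [hy0] using ρ.rel.add_mem h hy

/-- Every normed space presents itself over a one-point index set. -/
def GermPresentation.self (X : Type*) [NormedAddCommGroup X] [NormedSpace ℝ X] :
    GermPresentation ((pure PUnit.unit : Ultrafilter PUnit) : Filter PUnit) X X where
  rel :=
    { carrier := {q | q.1 PUnit.unit = q.2}
      zero_mem' := rfl
      add_mem' := fun {q q'} (h : _ = _) (h' : _ = _) => by simp [h, h']
      smul_mem' := fun c q (h : _ = _) => by simp [h] }
  exists_fun x := ⟨fun _ => x, rfl⟩
  exists_vec a _ _ := ⟨a PUnit.unit, rfl⟩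
  eventually_lt := by
    rintro a x r (h : a PUnit.unit = x) hr
    simpa [h] using hr
  norm_le := by
    rintro a x r (h : a PUnit.unit = x) _ hr
    simpa [h] using hr

theorem Ultrapower.mk_eq_mk {I : Type u} {D : Ultrafilter I} {X : Type u}
    [NormedAddCommGroup X] [NormedSpace ℝ X] {F F' : lp (fun _ : I => X) ∞}
    (h : ∀ᶠ i in (D : Filter I), F i = F' i) :
    (Submodule.Quotient.mk F : Ultrapower I D X) = Submodule.Quotient.mk F' := by
  rw [Submodule.Quotient.eq]
  refine tendsto_const_nhds.congr' (h.mono fun i hi => ?_)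
  simp [hi]

theorem Ultrapower.eventually_norm_lt {I : Type u} {D : Ultrafilter I} {X : Type u}
    [NormedAddCommGroup X] [NormedSpace ℝ X] {F : lp (fun _ : I => X) ∞} {r : ℝ}
    (h : ‖(Submodule.Quotient.mk F : Ultrapower I D X)‖ < r) :
    ∀ᶠ i in (D : Filter I), ‖F i‖ < r := by
  obtain ⟨F', hF', hlt⟩ :=
    Submodule.Quotient.norm_mk_lt (Submodule.Quotient.mk F : Ultrapower I D X) (sub_pos.2 h)
  rw [add_sub_cancel] at hlt
  have hnull : Tendsto (fun i => ‖(F - F') i‖) (D : Filter I) (𝓝 0) :=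
    (Submodule.Quotient.eq _).1 hF'.symm
  refine (hnull.eventually_lt_const (sub_pos.2 hlt)).mono fun i hi => ?_
  have h1 : ‖F i‖ ≤ ‖(F - F') i‖ + ‖F' i‖ := by
    simpa using norm_add_le ((F - F') i) (F' i)
  have h2 := lp.norm_apply_le_norm (E := fun _ : I => X) ENNReal.top_ne_zero F' i
  linarith

theorem Ultrapower.norm_mk_le {I : Type u} {D : Ultrafilter I} {X : Type u}
    [NormedAddCommGroup X] [NormedSpace ℝ X] {F : lp (fun _ : I => X) ∞} {r : ℝ} (hr : 0 ≤ r)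
    (h : ∀ᶠ i in (D : Filter I), ‖F i‖ ≤ r) :
    ‖(Submodule.Quotient.mk F : Ultrapower I D X)‖ ≤ r := by
  classical
  have hb : ∀ i, ‖if ‖F i‖ ≤ r then F i else 0‖ ≤ r := by
    intro i
    split_ifs with hi
    exacts [hi, by simpa using hr]
  let F' : lp (fun _ : I => X) ∞ := ⟨fun i => if ‖F i‖ ≤ r then F i else 0,
    memℓp_infty ⟨r, by rintro _ ⟨i, rfl⟩; exact hb i⟩⟩
  have hF' : ∀ᶠ i in (D : Filter I), F i = F' i := h.mono fun i hi => (if_pos hi).symm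
  rw [Ultrapower.mk_eq_mk hF']
  exact (Submodule.Quotient.norm_mk_le _ _).trans (lp.norm_le_of_forall_le hr hb)

/-- A presentation of `V` induces one of its ultrapowers. -/
def GermPresentation.ultrapower {P : Type*} {l : Filter P} {X : Type*} {V : Type u}
    [NormedAddCommGroup X] [NormedSpace ℝ X] [NormedAddCommGroup V] [NormedSpace ℝ V]
    (ρ : GermPresentation l X V) (Λ : Type u) (G : Ultrafilter Λ) :
    GermPresentation ((G : Filter Λ).curry l) X (Ultrapower Λ G V) where
  rel :=
    { carrier := {q | ∃ F : lp (fun _ : Λ => V) ∞, Submodule.Quotient.mk F = q.2 ∧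
        ∀ᶠ k in (G : Filter Λ), ((fun p => q.1 (k, p)), F k) ∈ ρ.rel}
      zero_mem' := ⟨0, rfl, Eventually.of_forall fun _ => ρ.rel.zero_mem⟩
      add_mem' := by
        rintro ⟨a, x⟩ ⟨b, y⟩ ⟨F, rfl, hF⟩ ⟨F', rfl, hF'⟩
        exact ⟨F + F', rfl, hF.mp (hF'.mono fun k h' h => ρ.rel.add_mem h h')⟩
      smul_mem' := by
        rintro c ⟨a, x⟩ ⟨F, rfl, hF⟩
        exact ⟨c • F, rfl, hF.mono fun k h => ρ.rel.smul_mem c h⟩ }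
  exists_fun x := by
    obtain ⟨F, rfl⟩ := Submodule.Quotient.mk_surjective _ x
    choose a ha using fun k => ρ.exists_fun (F k)
    exact ⟨fun q => a q.1 q.2, F, rfl, Eventually.of_forall ha⟩
  exists_vec a C h := by
    classical
    rw [eventually_curry_iff] at h
    have hex : ∀ k, ∃ x : V, ‖x‖ ≤ max C 0 ∧
        ((∀ᶠ p in l, ‖a (k, p)‖ ≤ C) → ((fun p => a (k, p)), x) ∈ ρ.rel) := by
      intro k
      by_cases hk : ∀ᶠ p in l, ‖a (k, p)‖ ≤ C
      · obtain ⟨x, hx⟩ := ρ.exists_vec (fun p => a (k, p)) C hk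
        exact ⟨x, ρ.norm_le hx (le_max_right _ _) (hk.mono fun p hp => hp.trans (le_max_left _ _)),
          fun _ => hx⟩
      · exact ⟨0, by simp, fun h' => absurd h' hk⟩
    choose F hF hFrel using hex
    exact ⟨_, ⟨F, memℓp_infty ⟨max C 0, by rintro _ ⟨k, rfl⟩; exact hF k⟩⟩, rfl,
      h.mono fun k hk => hFrel k hk⟩
  eventually_lt := by
    rintro a x r ⟨F, rfl, hF⟩ h
    rw [eventually_curry_iff]
    exact hF.mp ((Ultrapower.eventually_norm_lt h).mono fun k hk hrel => ρ.eventually_lt hrel hk)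
  norm_le := by
    rintro a x r ⟨F, rfl, hF⟩ hr h
    rw [eventually_curry_iff] at h
    exact Ultrapower.norm_mk_le hr (hF.mp (h.mono fun k hk hrel => ρ.norm_le hrel hr hk))

theorem GermPresentation.norm_le_of_matching {P P' X V W : Type*} {l : Filter P} {l' : Filter P'}
    [NormedAddCommGroup X] [NormedSpace ℝ X] [NormedAddCommGroup V] [NormedSpace ℝ V]
    [NormedAddCommGroup W] [NormedSpace ℝ W] (ρ : GermPresentation l X V)
    (ρ' : GermPresentation l' X W) {a : P → X} {b : P' → X} {x : V} {y : W}
    (hx : (a, x) ∈ ρ.rel) (hy : (b, y) ∈ ρ'.rel)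
    (h : ∀ r : ℝ, (∀ᶠ p in l, ‖a p‖ < r) → ∀ᶠ p in l', ‖b p‖ < r) : ‖y‖ ≤ ‖x‖ :=
  le_of_forall_gt_imp_ge_of_dense fun r hr => ρ'.norm_le hy ((norm_nonneg x).trans hr.le)
    ((h r (ρ.eventually_lt hx hr)).mono fun _ => le_of_lt)

/-- A total correspondence preserving ternary relations almost everywhere induces an isometric
isomorphism of the presented spaces. -/
theorem GermPresentation.nonempty_linearIsometryEquiv {P P' X V W : Type*} {l : Filter P}
    {l' : Filter P'} [NormedAddCommGroup X] [NormedSpace ℝ X] [NormedAddCommGroup V]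
    [NormedSpace ℝ V] [NormedAddCommGroup W] [NormedSpace ℝ W] (ρ : GermPresentation l X V)
    (ρ' : GermPresentation l' X W) (M : Set ((P → X) × (P' → X))) (hl : ∀ a, ∃ b, (a, b) ∈ M)
    (hr : ∀ b, ∃ a, (a, b) ∈ M)
    (hM : ∀ m₁ ∈ M, ∀ m₂ ∈ M, ∀ m₃ ∈ M, ∀ R : X → X → X → Prop,
      (∀ᶠ p in l, R (m₁.1 p) (m₂.1 p) (m₃.1 p)) ↔ ∀ᶠ p in l', R (m₁.2 p) (m₂.2 p) (m₃.2 p)) :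
    Nonempty (V ≃ₗᵢ[ℝ] W) := by
  have hnorm : ∀ m ∈ M, ∀ r : ℝ, (∀ᶠ p in l, ‖m.1 p‖ < r) ↔ ∀ᶠ p in l', ‖m.2 p‖ < r :=
    fun m hm r => hM m hm m hm m hm fun x _ _ => ‖x‖ < r
  let Rel : V → W → Prop := fun x y => ∃ m ∈ M, (m.1, x) ∈ ρ.rel ∧ (m.2, y) ∈ ρ'.rel
  have hRel_norm : ∀ {x y}, Rel x y → ‖y‖ = ‖x‖ := by
    rintro x y ⟨m, hm, hx, hy⟩
    exact le_antisymm (ρ.norm_le_of_matching ρ' hx hy fun r => (hnorm m hm r).1)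
      (ρ'.norm_le_of_matching ρ hy hx fun r => (hnorm m hm r).2)
  have hRel_add : ∀ {x y x' y'}, Rel x y → Rel x' y' → Rel (x + x') (y + y') := by
    rintro x y x' y' ⟨m, hm, hx, hy⟩ ⟨m', hm', hx', hy'⟩
    obtain ⟨b, hb⟩ := hl (m.1 + m'.1)
    refine ⟨_, hb, ρ.rel.add_mem hx hx', ρ'.congr (ρ'.rel.add_mem hy hy') ?_⟩
    exact (hM _ hm _ hm' _ hb fun x y z => x + y = z).1 (Eventually.of_forall fun _ => rfl)
  have hRel_smul : ∀ (c : ℝ) {x y}, Rel x y → Rel (c • x) (c • y) := by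
    rintro c x y ⟨m, hm, hx, hy⟩
    obtain ⟨b, hb⟩ := hl (c • m.1)
    refine ⟨_, hb, ρ.rel.smul_mem c hx, ρ'.congr (ρ'.rel.smul_mem c hy) ?_⟩
    exact (hM _ hm _ hm _ hb fun x _ z => c • x = z).1 (Eventually.of_forall fun _ => rfl)
  have hRel_left : ∀ x, ∃ y, Rel x y := by
    intro x
    obtain ⟨a, ha⟩ := ρ.exists_fun x
    obtain ⟨b, hb⟩ := hl a
    obtain ⟨y, hy⟩ := ρ'.exists_vec b (‖x‖ + 1)
      (((hnorm _ hb _).1 (ρ.eventually_lt ha (lt_add_one _))).mono fun _ => le_of_lt)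
    exact ⟨y, _, hb, ha, hy⟩
  have hRel_right : ∀ y, ∃ x, Rel x y := by
    intro y
    obtain ⟨b, hb⟩ := ρ'.exists_fun y
    obtain ⟨a, ha⟩ := hr b
    obtain ⟨x, hx⟩ := ρ.exists_vec a (‖y‖ + 1)
      (((hnorm _ ha _).2 (ρ'.eventually_lt hb (lt_add_one _))).mono fun _ => le_of_lt)
    exact ⟨x, _, ha, hx, hb⟩
  have hRel_unique : ∀ {x y y'}, Rel x y → Rel x y' → y = y' := by
    intro x y y' h h'
    have := hRel_norm (hRel_add h (hRel_smul (-1) h'))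
    rw [neg_one_smul, neg_one_smul, add_neg_cancel, norm_zero, norm_eq_zero] at this
    exact add_neg_eq_zero.1 this
  choose T hT using hRel_left
  let T' : V →ₗᵢ[ℝ] W :=
    { toFun := T
      map_add' := fun x y => hRel_unique (hT _) (hRel_add (hT x) (hT y))
      map_smul' := fun c x => hRel_unique (hT _) (hRel_smul c (hT x))
      norm_map' := fun x => hRel_norm (hT x) }
  refine ⟨LinearIsometryEquiv.ofSurjective T' fun y => ?_⟩
  obtain ⟨x, hx⟩ := hRel_right y
  exact ⟨x, hRel_unique (hT x) hx⟩

/-- Spaces presented by functions into the same `X` along ultrafilters have isometrically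
isomorphic ultrapowers. -/
theorem GermPresentation.exists_ultrapower_equiv {X V W I J : Type u} [NormedAddCommGroup X]
    [NormedSpace ℝ X] [NormedAddCommGroup V] [NormedSpace ℝ V] [NormedAddCommGroup W]
    [NormedSpace ℝ W] {D : Ultrafilter I} {E : Ultrafilter J}
    (ρ : GermPresentation (D : Filter I) X V) (ρ' : GermPresentation (E : Filter J) X W) :
    ∃ (K : Type u) (G : Ultrafilter K), Nonempty (Ultrapower K G V ≃ₗᵢ[ℝ] Ultrapower K G W) := by
  classical
  obtain ⟨Λ, G, M, hl, hr, hM⟩ := exists_ultrafilter_correspondence (X := X) D E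
  refine ⟨Λ, G, (ρ.ultrapower Λ G).nonempty_linearIsometryEquiv (ρ'.ultrapower Λ G)
    {q | (Function.curry q.1, Function.curry q.2) ∈ M} (fun a => ?_) (fun b => ?_) ?_⟩
  · obtain ⟨b, hb⟩ := hl (Function.curry a)
    exact ⟨Function.uncurry b, hb⟩
  · obtain ⟨a, ha⟩ := hr (Function.curry b)
    exact ⟨Function.uncurry a, ha⟩
  · intro m₁ h₁ m₂ h₂ m₃ h₃ R
    rw [eventually_curry_iff, eventually_curry_iff]
    refine hM (fun x => R (x (Function.curry m₁.1, Function.curry m₁.2))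
      (x (Function.curry m₂.1, Function.curry m₂.2))
      (x (Function.curry m₃.1, Function.curry m₃.2)))
      ⟨{(Function.curry m₁.1, Function.curry m₁.2), (Function.curry m₂.1, Function.curry m₂.2),
        (Function.curry m₃.1, Function.curry m₃.2)}, ?_, fun x y hxy => ?_⟩
    · rintro m hm
      simp only [Finset.coe_insert, Finset.coe_singleton, Set.mem_insert_iff,
        Set.mem_singleton_iff] at hm
      rcases hm with rfl | rfl | rfl
      exacts [h₁, h₂, h₃]
    · beta_reduce
      rw [hxy (Function.curry m₁.1, Function.curry m₁.2) (by simp),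
        hxy (Function.curry m₂.1, Function.curry m₂.2) (by simp),
        hxy (Function.curry m₃.1, Function.curry m₃.2) (by simp)]

theorem exists_germPresentation_ultrapower (X I : Type u) [NormedAddCommGroup X] [NormedSpace ℝ X]
    (D : Ultrafilter I) : ∃ D' : Ultrafilter (I × PUnit.{u + 1}),
      Nonempty (GermPresentation (D' : Filter (I × PUnit.{u + 1})) X (Ultrapower I D X)) := by
  refine ⟨D.map fun i => (i, PUnit.unit), ?_⟩
  have h : ((D.map fun i => (i, PUnit.unit) : Ultrafilter (I × PUnit.{u + 1})) : Filter _) =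
      (D : Filter I).curry ((pure PUnit.unit : Ultrafilter PUnit.{u + 1}) : Filter PUnit) := by
    ext s
    change _ ↔ ∀ᶠ q in (D : Filter I).curry _, q ∈ s
    rw [eventually_curry_iff]
    simp only [Ultrafilter.coe_pure, Filter.eventually_pure]
    exact Iff.rfl
  rw [h]
  exact ⟨(GermPresentation.self X).ultrapower I D⟩

/-- **Keisler–Shelah theorem for Banach spaces.** For every Banach space `X`
and ultrafilters `D`, `E`, there is an ultrafilter `G` with `((X)_D)_G ≅ ((X)_E)_G`
isometrically; in particular `X ≡ (X)_D` for every ultrafilter `D`. -/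
theorem keisler_shelah_banach
    (X : Type u) [NormedAddCommGroup X] [NormedSpace ℝ X] [CompleteSpace X]
    (I J : Type u) (D : Ultrafilter I) (E : Ultrafilter J) :
    (∃ (K : Type u) (G : Ultrafilter K),
      Nonempty ((Ultrapower K G (Ultrapower I D X)) ≃ₗᵢ[ℝ]
        (Ultrapower K G (Ultrapower J E X)))) ∧
    ElemEquiv X (Ultrapower I D X) := by
  obtain ⟨D', ⟨ρ⟩⟩ := exists_germPresentation_ultrapower X I D
  obtain ⟨E', ⟨ρ'⟩⟩ := exists_germPresentation_ultrapower X J E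
  exact ⟨ρ.exists_ultrapower_equiv ρ', (GermPresentation.self X).exists_ultrapower_equiv ρ⟩
end
end

section
/- The relation of elementary equivalence X ≡ Y is an equivalence relation on Banach spaces; in particular it is transitive: if X ≡ Y and Y ≡ Z, then X ≡ Z. -/
open Filter Topology
open scoped ENNReal

noncomputable section

universe u

section BoundedFamilies

variable {I X Y : Type u} [NormedAddCommGroup X] [NormedAddCommGroup Y]

lemma lp_infty_norm_apply_le (f : lp (fun _ : I => X) ∞) (i : I) : ‖f i‖ ≤ ‖f‖ :=
  lp.norm_apply_le_norm ENNReal.top_ne_zero f i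

/-- The element of `ℓ∞(I, X)` given by a family bounded by `C`. -/
def lpOfBound (f : I → X) (C : ℝ) (h : ∀ i, ‖f i‖ ≤ C) : lp (fun _ : I => X) ∞ :=
  ⟨f, memℓp_infty ⟨C, by rintro _ ⟨i, rfl⟩; exact h i⟩⟩

@[simp]
lemma lpOfBound_apply (f : I → X) (C : ℝ) (h : ∀ i, ‖f i‖ ≤ C) (i : I) :
    lpOfBound f C h i = f i := rfl

/-- The pairs of values at `i` of the pairs of bounded families in `l`. -/
def evalPairs (l : List (lp (fun _ : I => X) ∞ × lp (fun _ : I => Y) ∞)) (i : I) : Set (X × Y) :=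
  (fun p => (p.1 i, p.2 i)) '' {p | p ∈ l}

lemma evalPairs_cons (a : lp (fun _ : I => X) ∞) (b : lp (fun _ : I => Y) ∞)
    (l : List (lp (fun _ : I => X) ∞ × lp (fun _ : I => Y) ∞)) (i : I) :
    evalPairs ((a, b) :: l) i = insert (a i, b i) (evalPairs l i) := by
  ext; simp [evalPairs, eq_comm]

lemma evalPairs_mono {l l' : List (lp (fun _ : I => X) ∞ × lp (fun _ : I => Y) ∞)}
    (h : l ⊆ l') (i : I) : evalPairs l i ⊆ evalPairs l' i :=
  Set.image_mono fun _ hp => h hp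

lemma evalPairs_swap (l : List (lp (fun _ : I => X) ∞ × lp (fun _ : I => Y) ∞)) (i : I) :
    evalPairs (l.map Prod.swap) i = Prod.swap '' evalPairs l i := by
  have h : {p | p ∈ l.map Prod.swap} = Prod.swap '' {p | p ∈ l} := by
    ext p
    rw [Set.mem_ofPred_eq, List.mem_map]
    rfl
  rw [evalPairs, h, evalPairs, Set.image_image, Set.image_image]
  rfl

end BoundedFamilies

section Ultrapower

variable {I : Type u} {D : Ultrafilter I} {X Y : Type u}
  [NormedAddCommGroup X] [NormedSpace ℝ X] [NormedAddCommGroup Y] [NormedSpace ℝ Y]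

/-- The norm of an element of an ultrapower is the limit of the norms of a representative. -/
lemma Ultrapower.tendsto_norm (f : lp (fun _ : I => X) ∞) :
    Tendsto (fun i => ‖f i‖) D (𝓝 ‖(Submodule.Quotient.mk f : Ultrapower I D X)‖) := by
  obtain ⟨L, hL, hlim⟩ : ∃ L ∈ Set.Icc 0 ‖f‖, Tendsto (fun i => ‖f i‖) D (𝓝 L) :=
    (isCompact_Icc (a := (0 : ℝ)) (b := ‖f‖)).ultrafilter_le_nhds (D.map fun i => ‖f i‖)
      (le_principal_iff.2 <| Filter.mem_map.2 <| Filter.univ_mem'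
        fun i => ⟨norm_nonneg _, lp_infty_norm_apply_le f i⟩)
  suffices ‖(Submodule.Quotient.mk f : Ultrapower I D X)‖ = L by rwa [this]
  refine le_antisymm (le_of_forall_pos_le_add fun ε hε => ?_)
    (le_of_forall_pos_le_add fun ε hε => ?_)
  · classical
    have hb : ∀ i, ‖if ‖f i‖ ≤ L + ε then f i else 0‖ ≤ L + ε := fun i => by
      have := hL.1
      split_ifs with h
      · exact h
      · simp; positivity
    have heq : (Submodule.Quotient.mk f : Ultrapower I D X) =
        Submodule.Quotient.mk (lpOfBound _ _ hb) := by
      rw [Submodule.Quotient.eq]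
      refine tendsto_const_nhds.congr' ?_
      filter_upwards [hlim.eventually_le_const (lt_add_of_pos_right L hε)] with i hi
      simp [hi]
    rw [heq]
    exact (Submodule.Quotient.norm_mk_le _ _).trans
      (lp.norm_le_of_forall_le (add_nonneg hL.1 hε.le) hb)
  · obtain ⟨g, hg, hlt⟩ := Submodule.Quotient.norm_mk_lt
      (Submodule.Quotient.mk f : Ultrapower I D X) hε
    have hnull : Tendsto (fun i => ‖(g - f) i‖) D (𝓝 0) := (Submodule.Quotient.eq _).1 hg
    refine le_trans ?_ hlt.le
    refine le_of_tendsto (by simpa using hlim.sub hnull) (Eventually.of_forall fun i => ?_)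
    have h1 := norm_sub_norm_le (f i) (f i - g i)
    have h2 := lp_infty_norm_apply_le g i
    rw [sub_sub_cancel, norm_sub_rev] at h1
    exact h1.trans h2

lemma Ultrapower.tendsto_dist (f g : lp (fun _ : I => X) ∞) :
    Tendsto (fun i => dist (f i) (g i)) D
      (𝓝 (dist (Submodule.Quotient.mk f : Ultrapower I D X) (Submodule.Quotient.mk g))) := by
  have h := Ultrapower.tendsto_norm (D := D) (f - g)
  rw [Submodule.Quotient.mk_sub, ← dist_eq_norm] at h
  simpa [dist_eq_norm] using h

instance ultraNullIdeal.isClosed :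
    IsClosed (ultraNullIdeal I D X : Set (lp (fun _ : I => X) ∞)) := by
  have : (ultraNullIdeal I D X : Set (lp (fun _ : I => X) ∞)) =
      (fun f => ‖(Submodule.Quotient.mk f : Ultrapower I D X)‖) ⁻¹' {0} := by
    ext f
    refine ⟨fun h => tendsto_nhds_unique (Ultrapower.tendsto_norm f) h, fun h => ?_⟩
    have h' := Ultrapower.tendsto_norm (D := D) f
    rwa [show ‖(Submodule.Quotient.mk f : Ultrapower I D X)‖ = 0 from h] at h'
  rw [this]
  refine isClosed_singleton.preimage ?_
  refine (LipschitzWith.of_dist_le_mul (K := 1) fun f g => ?_).continuous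
  rw [NNReal.coe_one, one_mul, Real.dist_eq, dist_eq_norm]
  exact (abs_norm_sub_norm_le _ _).trans
    (by rw [← Submodule.Quotient.mk_sub]; exact Submodule.Quotient.norm_mk_le _ _)

end Ultrapower

section BackForth

variable {X Y Z : Type*} [NormedAddCommGroup X] [NormedAddCommGroup Y] [NormedAddCommGroup Z]

/-- The relation `s` is an `ε`-isometric position from which a back-and-forth game of `k` rounds,
with challenges of norm at most `M`, can be continued up to an error `ε`. -/
def BackForth (M ε : ℝ) : ℕ → Set (X × Z) → Prop
  | 0, s => (∀ p ∈ s, |‖p.1‖ - ‖p.2‖| ≤ ε) ∧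
      ∀ p ∈ s, ∀ q ∈ s, |dist p.1 q.1 - dist p.2 q.2| ≤ ε
  | k + 1, s => (∀ x, ‖x‖ ≤ M → ∃ z, BackForth M ε k (insert (x, z) s)) ∧
      ∀ z, ‖z‖ ≤ M → ∃ x, BackForth M ε k (insert (x, z) s)

namespace BackForth

variable {M M' ε ε' : ℝ} {k k' : ℕ} {s t : Set (X × Z)}

lemma subset (h : BackForth M ε k t) (hst : s ⊆ t) : BackForth M ε k s := by
  induction k generalizing s t with
  | zero => exact ⟨fun p hp => h.1 p (hst hp), fun p hp q hq => h.2 p (hst hp) q (hst hq)⟩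
  | succ k ih =>
    exact ⟨fun x hx => (h.1 x hx).imp fun z hz => ih hz (Set.insert_subset_insert hst),
      fun z hz => (h.2 z hz).imp fun x hx => ih hx (Set.insert_subset_insert hst)⟩

lemma of_succ (hM : 0 ≤ M) (h : BackForth M ε (k + 1) s) : BackForth M ε k s := by
  obtain ⟨z, hz⟩ := h.1 0 (by simpa)
  exact hz.subset (Set.subset_insert _ _)

lemma of_le (hM : 0 ≤ M) (h : BackForth M ε k s) (hk : k' ≤ k) : BackForth M ε k' s := by
  induction hk with
  | refl => exact h
  | step _ ih => exact ih (h.of_succ hM)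

lemma weaken (h : BackForth M ε k s) (hM : M' ≤ M) (hε : ε ≤ ε') : BackForth M' ε' k s := by
  induction k generalizing s with
  | zero => exact ⟨fun p hp => (h.1 p hp).trans hε, fun p hp q hq => (h.2 p hp q hq).trans hε⟩
  | succ k ih =>
    exact ⟨fun x hx => (h.1 x (hx.trans hM)).imp fun z hz => ih hz,
      fun z hz => (h.2 z (hz.trans hM)).imp fun x hx => ih hx⟩

lemma swap (h : BackForth M ε k s) : BackForth M ε k (Prod.swap '' s) := by
  induction k generalizing s with
  | zero =>
    refine ⟨?_, ?_⟩
    · rintro _ ⟨p, hp, rfl⟩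
      rw [abs_sub_comm]
      exact h.1 p hp
    · rintro _ ⟨p, hp, rfl⟩ _ ⟨q, hq, rfl⟩
      rw [abs_sub_comm]
      exact h.2 p hp q hq
  | succ k ih =>
    refine ⟨fun z hz => (h.2 z hz).imp fun x hx => ?_, fun x hx => (h.1 x hx).imp fun z hz => ?_⟩
    · simpa [Set.image_insert_eq] using ih hx
    · simpa [Set.image_insert_eq] using ih hz

lemma comp {s : Set (X × Y)} {t : Set (Y × Z)} {r : Set (X × Z)} (hε : 0 ≤ ε) (hM : 0 ≤ M)
    (hs : BackForth (M + ε) ε k s) (ht : BackForth (M + ε) ε k t)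
    (hr : ∀ p ∈ r, ∃ y, (p.1, y) ∈ s ∧ (y, p.2) ∈ t) : BackForth M (2 * ε) k r := by
  induction k generalizing s t r with
  | zero =>
    refine ⟨fun p hp => ?_, fun p hp q hq => ?_⟩
    · obtain ⟨y, h1, h2⟩ := hr p hp
      refine (abs_sub_le _ ‖y‖ _).trans ?_
      linarith [hs.1 _ h1, ht.1 _ h2]
    · obtain ⟨y, h1, h2⟩ := hr p hp
      obtain ⟨y', h1', h2'⟩ := hr q hq
      refine (abs_sub_le _ (dist y y') _).trans ?_
      linarith [hs.2 _ h1 _ h1', ht.2 _ h2 _ h2']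
  | succ k ih =>
    have hM' : 0 ≤ M + ε := by positivity
    refine ⟨fun x hx => ?_, fun z hz => ?_⟩
    · obtain ⟨y, hy⟩ := hs.1 x (by linarith)
      have hn := abs_le.1 ((hy.of_le hM' (Nat.zero_le _)).1 _ (Set.mem_insert _ _))
      obtain ⟨z, hz⟩ := ht.1 y (by linarith)
      refine ⟨z, ih hy hz ?_⟩
      rintro p (rfl | hp)
      · exact ⟨y, Set.mem_insert _ _, Set.mem_insert _ _⟩
      · exact (hr p hp).imp fun y' h => ⟨Or.inr h.1, Or.inr h.2⟩
    · obtain ⟨y, hy⟩ := ht.2 z (by linarith)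
      have hn := abs_le.1 ((hy.of_le hM' (Nat.zero_le _)).1 _ (Set.mem_insert _ _))
      obtain ⟨x, hx⟩ := hs.2 y (by linarith)
      refine ⟨x, ih hx hy ?_⟩
      rintro p (rfl | hp)
      · exact ⟨y, Set.mem_insert _ _, Set.mem_insert _ _⟩
      · exact (hr p hp).imp fun y' h => ⟨Or.inr h.1, Or.inr h.2⟩

end BackForth

/-- `BackForth` with bound, precision and length all governed by a single natural number. -/
def BackForthAt (n : ℕ) (s : Set (X × Z)) : Prop := BackForth (n : ℝ) (1 / ((n : ℝ) + 1)) n s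

namespace BackForthAt

variable {n m : ℕ} {s t : Set (X × Z)}

lemma subset (h : BackForthAt n t) (hst : s ⊆ t) : BackForthAt n s := BackForth.subset h hst

lemma mono (h : BackForthAt n s) (hmn : m ≤ n) : BackForthAt m s :=
  (BackForth.of_le (Nat.cast_nonneg n) h hmn).weaken (by exact_mod_cast hmn)
    (one_div_le_one_div_of_le (by positivity) (by gcongr))

lemma swap (h : BackForthAt n s) : BackForthAt n (Prod.swap '' s) := BackForth.swap h

lemma zero_level (h : BackForthAt n s) : BackForth (n : ℝ) (1 / ((n : ℝ) + 1)) 0 s :=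
  BackForth.of_le (Nat.cast_nonneg n) h (Nat.zero_le n)

lemma forth (h : BackForthAt (n + 1) s) {x : X} (hx : ‖x‖ ≤ n) :
    ∃ z, BackForthAt n (insert (x, z) s) := by
  obtain ⟨z, hz⟩ := BackForth.weaken (M' := n + 1) (ε' := 1 / ((n : ℝ) + 1)) h (by simp)
    (one_div_le_one_div_of_le (by positivity) (by push_cast; linarith)) |>.1 x (by linarith)
  exact ⟨z, hz.weaken (by linarith) le_rfl⟩

end BackForthAt

end BackForth

section Los

variable {I : Type u} {D : Ultrafilter I} {X Y Z : Type u}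
  [NormedAddCommGroup X] [NormedSpace ℝ X] [NormedAddCommGroup Y] [NormedSpace ℝ Y]
  [NormedAddCommGroup Z] [NormedSpace ℝ Z]

/-- The elements of an isometric pair of ultrapowers can be lifted to families that are almost
everywhere good positions of the back-and-forth game. -/
lemma eventually_backForth (T : Ultrapower I D X ≃ₗᵢ[ℝ] Ultrapower I D Y) {M ε : ℝ} (hM : 0 ≤ M)
    (hε : 0 < ε) (k : ℕ) (l : List (lp (fun _ : I => X) ∞ × lp (fun _ : I => Y) ∞))
    (hl : ∀ p ∈ l, T (Submodule.Quotient.mk p.1) = Submodule.Quotient.mk p.2) :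
    ∀ᶠ i in D, BackForth M ε k (evalPairs l i) := by
  induction k generalizing l with
  | zero =>
    have key : ∀ {u v : I → ℝ} {c : ℝ}, Tendsto u D (𝓝 c) → Tendsto v D (𝓝 c) →
        ∀ᶠ i in D, |u i - v i| ≤ ε := fun hu hv => by
      have h := (hu.sub hv).abs
      rw [sub_self, abs_zero] at h
      exact h.eventually_le_const hε
    have h1 : ∀ᶠ i in D, ∀ p ∈ {p | p ∈ l}, |‖p.1 i‖ - ‖p.2 i‖| ≤ ε := by
      refine (eventually_all_finite l.finite_toSet).2 fun p hp => ?_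
      refine key (Ultrapower.tendsto_norm p.1) ?_
      rw [← T.norm_map, hl p hp]
      exact Ultrapower.tendsto_norm p.2
    have h2 : ∀ᶠ i in D, ∀ p ∈ {p | p ∈ l}, ∀ q ∈ {q | q ∈ l},
        |dist (p.1 i) (q.1 i) - dist (p.2 i) (q.2 i)| ≤ ε := by
      refine (eventually_all_finite l.finite_toSet).2 fun p hp =>
        (eventually_all_finite l.finite_toSet).2 fun q hq => ?_
      refine key (Ultrapower.tendsto_dist p.1 q.1) ?_
      rw [← T.dist_map, hl p hp, hl q hq]
      exact Ultrapower.tendsto_dist p.2 q.2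
    filter_upwards [h1, h2] with i hi1 hi2
    refine ⟨?_, ?_⟩
    · rintro _ ⟨p, hp, rfl⟩
      exact hi1 p hp
    · rintro _ ⟨p, hp, rfl⟩ _ ⟨q, hq, rfl⟩
      exact hi2 p hp q hq
  | succ k ih =>
    have hx : ∀ i, ∃ x : X, ‖x‖ ≤ M ∧
        ((∃ y, BackForth M ε k (insert (x, y) (evalPairs l i))) →
          ∀ x', ‖x'‖ ≤ M → ∃ y, BackForth M ε k (insert (x', y) (evalPairs l i))) := fun i => by
      by_cases h : ∀ x', ‖x'‖ ≤ M → ∃ y, BackForth M ε k (insert (x', y) (evalPairs l i))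
      · exact ⟨0, by simpa, fun _ => h⟩
      · obtain ⟨x, hx⟩ := not_forall.1 h
        rw [Classical.not_imp] at hx
        exact ⟨x, hx.1, fun h' => absurd h' hx.2⟩
    have hy : ∀ i, ∃ y : Y, ‖y‖ ≤ M ∧
        ((∃ x, BackForth M ε k (insert (x, y) (evalPairs l i))) →
          ∀ y', ‖y'‖ ≤ M → ∃ x, BackForth M ε k (insert (x, y') (evalPairs l i))) := fun i => by
      by_cases h : ∀ y', ‖y'‖ ≤ M → ∃ x, BackForth M ε k (insert (x, y') (evalPairs l i))
      · exact ⟨0, by simpa, fun _ => h⟩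
      · obtain ⟨y, hy⟩ := not_forall.1 h
        rw [Classical.not_imp] at hy
        exact ⟨y, hy.1, fun h' => absurd h' hy.2⟩
    choose a ha hax using hx
    choose b hb hby using hy
    obtain ⟨b', hb'⟩ := Submodule.Quotient.mk_surjective _
      (T (Submodule.Quotient.mk (lpOfBound a M ha)))
    obtain ⟨a', ha'⟩ := Submodule.Quotient.mk_surjective _
      (T.symm (Submodule.Quotient.mk (lpOfBound b M hb)))
    have h1 := ih ((lpOfBound a M ha, b') :: l) fun p hp => by
      rcases List.mem_cons.1 hp with rfl | hp
      · exact hb'.symm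
      · exact hl p hp
    have h2 := ih ((a', lpOfBound b M hb) :: l) fun p hp => by
      rcases List.mem_cons.1 hp with rfl | hp
      · simp [ha']
      · exact hl p hp
    filter_upwards [h1, h2] with i hi1 hi2
    rw [evalPairs_cons] at hi1 hi2
    exact ⟨hax i ⟨_, hi1⟩, hby i ⟨_, hi2⟩⟩

lemma ElemEquiv.backForth_empty (h : ElemEquiv X Y) {M ε : ℝ} (hM : 0 ≤ M) (hε : 0 < ε) (k : ℕ) :
    BackForth M ε k (∅ : Set (X × Y)) := by
  obtain ⟨I, D, ⟨T⟩⟩ := h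
  obtain ⟨i, hi⟩ := (eventually_backForth T hM hε k [] (by simp)).exists
  simpa [evalPairs] using hi

lemma ElemEquiv.backForthAt_trans (h : ElemEquiv X Y) (h' : ElemEquiv Y Z) (n : ℕ) :
    BackForthAt n (∅ : Set (X × Z)) := by
  have hε : 0 < 1 / ((n : ℝ) + 1) / 2 := by positivity
  have hM : 0 ≤ (n : ℝ) + 1 / ((n : ℝ) + 1) / 2 := by positivity
  refine ((h.backForth_empty hM hε n).comp hε.le (Nat.cast_nonneg n)
    (h'.backForth_empty hM hε n) (r := ∅) (by simp)).weaken le_rfl (by linarith)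

end Los

section Transfinite

open Cardinal

/-- A transfinite construction principle: if consistency of a set passes to unions of chains and
every requirement can be met by a consistent enlargement of small cardinality, then `κ`
requirements can be met simultaneously. -/
lemma exists_forall_meets {S W : Type u} {Con : Set S → Prop} {Meets : W → Set S → Prop}
    {μ κ : Cardinal.{u}} (hμ : ℵ₀ ≤ μ) (hμκ : μ < κ) (hW : #W ≤ κ) (h0 : Con ∅)
    (hmono : ∀ w s t, s ⊆ t → Meets w s → Meets w t)
    (hchain : ∀ c : Set (Set S), c.Nonempty → IsChain (· ⊆ ·) c → (∀ s ∈ c, Con s) → Con (⋃₀ c))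
    (hstep : ∀ s, Con s → #s < κ → ∀ w, ∃ t, s ⊆ t ∧ Con t ∧ Meets w t ∧ #t ≤ max #s μ) :
    ∃ s, Con s ∧ ∀ w, Meets w s := by
  classical
  let O := κ.ord.ToType
  obtain ⟨j⟩ : Nonempty (W ↪ O) := by
    rw [← Cardinal.le_def]
    simpa [O] using hW
  let Spec : O → Set S → Set S → Prop := fun o s t =>
    s ⊆ t ∧ Con t ∧ (∀ w, j w = o → Meets w t) ∧ #t ≤ max #s μ
  have hspec : ∀ o s, Con s → #s < κ → ∃ t, Spec o s t := fun o s hs hsκ => by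
    by_cases ho : ∃ w, j w = o
    · obtain ⟨w, rfl⟩ := ho
      obtain ⟨t, h1, h2, h3, h4⟩ := hstep s hs hsκ w
      exact ⟨t, h1, h2, fun w' hw' => j.injective hw' ▸ h3, h4⟩
    · exact ⟨s, subset_rfl, hs, fun w hw => absurd ⟨w, hw⟩ ho, le_max_left _ _⟩
  let next : O → Set S → Set S := fun o s => if h : ∃ t, Spec o s t then h.choose else ∅
  let T : O → Set S := wellFounded_lt.fix fun o T => next o (⋃ v : Set.Iio o, T v.1 v.2)
  have hT : ∀ o, T o = next o (⋃ v : Set.Iio o, T v.1) := fun o => wellFounded_lt.fix_eq _ o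
  have hchainT : ∀ A : Set O, (∀ o ∈ A, ∀ v ∈ A, v < o → T v ⊆ T o) →
      (∀ o ∈ A, Con (T o)) → Con (⋃ v : A, T v.1) := fun A hA hAC => by
    rcases A.eq_empty_or_nonempty with rfl | hne
    · simpa using h0
    have : ⋃ v : A, T v.1 = ⋃₀ (T '' A) := by
      rw [Set.sUnion_image, Set.biUnion_eq_iUnion]
    rw [this]
    refine hchain _ (hne.image T) ?_ ?_
    · rintro _ ⟨o, ho, rfl⟩ _ ⟨v, hv, rfl⟩ hov
      rcases lt_trichotomy o v with h | rfl | h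
      · exact Or.inl (hA v hv o ho h)
      · exact absurd rfl hov
      · exact Or.inr (hA o ho v hv h)
    · rintro _ ⟨o, ho, rfl⟩
      exact hAC o ho
  have main : ∀ o, Spec o (⋃ v : Set.Iio o, T v.1) (T o) ∧ #(T o) ≤ max #(Set.Iio o) μ := by
    intro o
    induction o using WellFoundedLT.induction with
    | ind o ih =>
    have hsub : ∀ a < o, ∀ v < a, T v ⊆ T a := fun a ha v hva =>
      (Set.subset_iUnion (fun v : Set.Iio a => T v.1) ⟨v, hva⟩).trans (ih a ha).1.1
    have hcard : #(⋃ v : Set.Iio o, T v.1) ≤ max #(Set.Iio o) μ := by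
      refine (mk_iUnion_le _).trans ?_
      have hb : ⨆ v : Set.Iio o, #(T v.1) ≤ max #(Set.Iio o) μ := ciSup_le' fun v =>
        (ih v.1 v.2).2.trans (max_le_max_right _ (mk_le_mk_of_subset (Set.Iio_subset_Iio v.2.le)))
      calc _ ≤ max #(Set.Iio o) μ * max #(Set.Iio o) μ := mul_le_mul' (le_max_left _ _) hb
        _ = _ := mul_eq_self (hμ.trans (le_max_right _ _))
    have hlt : #(⋃ v : Set.Iio o, T v.1) < κ :=
      hcard.trans_lt (max_lt ((mk_Iio_lt o (by simp [O])).trans_eq (by simp [O])) hμκ)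
    have hex := hspec o _ (hchainT (Set.Iio o) (fun a ha v _ hva => hsub a ha v hva)
      fun a ha => (ih a ha).1.2.1) hlt
    have hTo : Spec o (⋃ v : Set.Iio o, T v.1) (T o) := by
      have h := hex.choose_spec
      rw [hT o]
      simpa only [next, dif_pos hex] using h
    exact ⟨hTo, hTo.2.2.2.trans (max_le hcard (le_max_right _ _))⟩
  refine ⟨⋃ v : Set.univ, T v.1, hchainT Set.univ (fun a _ v _ hva => ?_)
    fun a _ => (main a).1.2.1, fun w => ?_⟩
  · exact (Set.subset_iUnion (fun v : Set.Iio a => T v.1) ⟨v, hva⟩).trans (main a).1.1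
  · exact hmono w _ _ (Set.subset_iUnion (fun v : (Set.univ : Set O) => T v.1) ⟨j w, trivial⟩)
      ((main (j w)).1.2.2.1 w rfl)

end Transfinite

section Independent

open Cardinal

variable {Ω K N : Type u}

/-- The index set of the Engelking–Karłowicz independent family. -/
abbrev EKIndex (N : Type u) : Type u := (N → Set N) × (N → N → Prop) × (N → N)

open Classical in
/-- The Engelking–Karłowicz family of functions, indexed by sets of subsets of `N`. -/
def ekFun [Inhabited N] (A : Set (Set N)) (k : EKIndex N) : N :=
  if h : ∃ t, k.2.1 t = fun j => k.1 j ∈ A then k.2.2 h.choose else default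

/-- Any `#N` many values of distinct Engelking–Karłowicz functions can be prescribed. -/
lemma ekFun_independent [Inhabited N] [Infinite N] (H : Set (Set (Set N)))
    (v : Set (Set N) → N) (hH : #H ≤ #N) : ∃ k, ∀ A ∈ H, ekFun A k = v A := by
  classical
  rcases H.eq_empty_or_nonempty with rfl | hne
  · exact ⟨default, by simp⟩
  have := hne.to_subtype
  obtain ⟨e⟩ := (Cardinal.le_def H N).1 hH
  obtain ⟨e₂⟩ : Nonempty (H × H ↪ N) := by
    rw [← Cardinal.le_def, ← Cardinal.mul_def]
    exact (mul_le_mul' hH hH).trans (mul_eq_self (aleph0_le_mk N)).le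
  have hsep : ∀ p : H × H, ∃ x : Set N, (x ∈ p.1.1 ↔ x ∈ p.2.1) → p.1 = p.2 := fun p => by
    by_cases h : p.1 = p.2
    · exact ⟨∅, fun _ => h⟩
    · have h' : ¬ ∀ x, x ∈ p.1.1 ↔ x ∈ p.2.1 := fun h' => h (Subtype.ext (Set.ext h'))
      obtain ⟨x, hx⟩ := not_forall.1 h'
      exact ⟨x, fun h => absurd h hx⟩
  choose σ hσ using hsep
  let S : N → Set N := fun n => σ (Function.invFun e₂ n)
  let c : N → H := Function.invFun e
  have hc : ∀ A, c (e A) = A := Function.leftInverse_invFun e.injective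
  refine ⟨(S, fun t j => S j ∈ (c t).1, fun t => v (c t).1), fun A hA => ?_⟩
  have hex : ∃ t, (fun j => S j ∈ (c t).1) = fun j => S j ∈ A := ⟨e ⟨A, hA⟩, by simp [hc]⟩
  have hAeq : c hex.choose = ⟨A, hA⟩ := by
    refine hσ (c hex.choose, ⟨A, hA⟩) ?_
    have h := congrFun hex.choose_spec (e₂ (c hex.choose, ⟨A, hA⟩))
    simpa [S, Function.leftInverse_invFun e₂.injective _] using h
  have h1 : ekFun A (S, fun t j => S j ∈ (c t).1, fun t => v (c t).1) = v (c hex.choose).1 :=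
    dif_pos hex
  rw [h1, hAeq]

lemma mk_ekIndex_le [Infinite N] : #(EKIndex N) ≤ 2 ^ #N := by
  have hN := aleph0_le_mk N
  have h : (2 ^ #N : Cardinal) ^ #N = 2 ^ #N := by rw [← power_mul, mul_eq_self hN]
  simp only [EKIndex, mk_prod, lift_id, mk_pi, prod_const, mk_set, mk_Prop, lift_two, lift_uzero,
    h, power_self_eq hN]
  rw [mul_eq_self, mul_eq_self]
  all_goals exact hN.trans (cantor _).le

lemma mk_lp_ekIndex_le {X : Type u} [NormedAddCommGroup X] [Infinite N] (hX : #X ≤ #N) :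
    #(lp (fun _ : EKIndex N => X) ∞) ≤ #(Set (Set N)) := by
  have hN := aleph0_le_mk N
  have h2 : ℵ₀ ≤ (2 : Cardinal) ^ #N := hN.trans (cantor _).le
  calc #(lp (fun _ : EKIndex N => X) ∞) ≤ #(EKIndex N → X) :=
        mk_le_of_injective (f := fun a => (a : EKIndex N → X)) Subtype.val_injective
    _ = #X ^ #(EKIndex N) := by simp
    _ ≤ (2 ^ #N) ^ (2 ^ #N : Cardinal) := by
        refine (power_le_power_right (hX.trans (cantor _).le)).trans ?_
        exact power_le_power_left (power_ne_zero _ two_ne_zero) mk_ekIndex_le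
    _ = #(Set (Set N)) := by rw [power_self_eq h2, mk_set, mk_set]

/-- If the functions `f A` for `A ∉ U` are independent over `E`, then after the removal of few
indices every remaining function can moreover be made to agree with a given function `g`. -/
lemma exists_agree_of_independent [Infinite N] (f : Ω → K → N) (E : Set K) (U : Set Ω)
    (hE : ∀ (H : Set Ω) (v : Ω → N), #H ≤ #N → Disjoint H U → ∃ i ∈ E, ∀ A ∈ H, f A i = v A)
    (g : K → N) :
    ∃ V : Set Ω, #V ≤ #N ∧ ∀ A, A ∉ U → A ∉ V → ∀ (H : Set Ω) (v : Ω → N), #H ≤ #N →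
      Disjoint H U → Disjoint H V → A ∉ H → ∃ i ∈ E, f A i = g i ∧ ∀ B ∈ H, f B i = v B := by
  classical
  let Bad : Set (Set Ω) := {S | Disjoint S U ∧ #S ≤ #N ∧ ∃ A ∈ S, ∃ v : Ω → N,
    ∀ i ∈ E, f A i = g i → ∃ B ∈ S, B ≠ A ∧ f B i ≠ v B}
  obtain ⟨M, hM⟩ := zorn_subset {M : Set (Set Ω) | M ⊆ Bad ∧ M.PairwiseDisjoint id} (by
    intro c hc hchain
    refine ⟨⋃₀ c, ⟨Set.sUnion_subset fun s hs => (hc hs).1, ?_⟩,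
      fun s hs => Set.subset_sUnion_of_mem hs⟩
    exact (Set.pairwiseDisjoint_sUnion hchain.directedOn).2 fun s hs => (hc hs).2)
  have hMcard : #M ≤ #N := by
    by_contra hcard
    obtain ⟨e⟩ := (Cardinal.le_def N M).1 (not_le.1 hcard).le
    have hbad : ∀ t, (e t).1 ∈ Bad := fun t => hM.prop.1 (e t).2
    choose hdU hle A hA v hv using hbad
    have huniq : ∀ B t t', B ∈ (e t).1 → B ∈ (e t').1 → t = t' := fun B t t' h h' => by
      by_contra hne
      refine Set.disjoint_left.1 (hM.prop.2 (e t).2 (e t').2 fun he => hne ?_) h h'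
      exact e.injective (Subtype.ext he)
    let w : Ω → N := fun B => if h : ∃ t, B ∈ (e t).1 then
      (if B = A h.choose then h.choose else v h.choose B) else Classical.arbitrary N
    have hw : ∀ t, ∀ B ∈ (e t).1, w B = if B = A t then t else v t B := fun t B hB => by
      have hex : ∃ t, B ∈ (e t).1 := ⟨t, hB⟩
      have : hex.choose = t := huniq B _ _ hex.choose_spec hB
      simp only [w, dif_pos hex, this]
    obtain ⟨i, hiE, hi⟩ := hE (⋃ t, (e t).1) w (by
      refine (mk_iUnion_le _).trans ?_
      exact (mul_le_mul' le_rfl (ciSup_le' hle)).trans (mul_eq_self (aleph0_le_mk N)).le)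
      (Set.disjoint_iUnion_left.2 hdU)
    have hmem : ∀ t, ∀ B ∈ (e t).1, f B i = if B = A t then t else v t B := fun t B hB => by
      rw [hi B (Set.mem_iUnion.2 ⟨t, hB⟩), hw t B hB]
    obtain ⟨B, hB, hne, hfB⟩ := hv (g i) i hiE (by rw [hmem _ _ (hA _), if_pos rfl])
    exact hfB (by rw [hmem _ _ hB, if_neg hne])
  refine ⟨⋃₀ M, ?_, fun A hAU hAV H v hH hHU hHV hAH => ?_⟩
  · rw [Set.sUnion_eq_iUnion]
    refine (mk_iUnion_le _).trans ?_
    exact (mul_le_mul' hMcard (ciSup_le' fun s => (hM.prop.1 s.2).2.1)).trans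
      (mul_eq_self (aleph0_le_mk N)).le
  · by_contra hcon
    push Not at hcon
    have hbad : insert A H ∈ Bad := by
      refine ⟨?_, ?_, A, Set.mem_insert _ _, v, fun i hi hAi => ?_⟩
      · rw [Set.disjoint_insert_left]
        exact ⟨hAU, hHU⟩
      · exact (mk_insert_le).trans (add_le_of_le (aleph0_le_mk N) hH
          (one_le_aleph0.trans (aleph0_le_mk N)))
      · obtain ⟨B, hB, hne⟩ := hcon i hi hAi
        exact ⟨B, Or.inr hB, fun h => hAH (h ▸ hB), hne⟩
    have hins : insert (insert A H) M ∈ {M : Set (Set Ω) | M ⊆ Bad ∧ M.PairwiseDisjoint id} := by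
      refine ⟨Set.insert_subset hbad hM.prop.1, hM.prop.2.insert fun S hS _ => ?_⟩
      rw [id, id, Set.disjoint_insert_left]
      exact ⟨fun h => hAV ⟨S, hS, h⟩, hHV.mono_right (Set.subset_sUnion_of_mem hS)⟩
    exact hAV ⟨insert A H, hM.le_of_ge hins (Set.subset_insert _ _) (Set.mem_insert _ _),
      Set.mem_insert _ _⟩

end Independent

section Consistent

open Cardinal

variable {Ω K N : Type u} {X Z : Type u} [NormedAddCommGroup X] [NormedAddCommGroup Z]

/-- The positions of the back-and-forth game formed from the pairs in `P` are simultaneously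
realised on sets over which the functions `f A` with `A ∉ U` are independent. -/
def Consistent (f : Ω → K → N) (P : Set (lp (fun _ : K => X) ∞ × lp (fun _ : K => Z) ∞))
    (U : Set Ω) : Prop :=
  ∀ l : List (lp (fun _ : K => X) ∞ × lp (fun _ : K => Z) ∞), (∀ p ∈ l, p ∈ P) →
    ∀ (n : ℕ) (H : Set Ω) (v : Ω → N), #H ≤ #N → Disjoint H U →
      ∃ i, BackForthAt n (evalPairs l i) ∧ ∀ A ∈ H, f A i = v A

variable {f : Ω → K → N} {P : Set (lp (fun _ : K => X) ∞ × lp (fun _ : K => Z) ∞)} {U : Set Ω}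

lemma Consistent.swap (h : Consistent f P U) : Consistent f (Prod.swap '' P) U := by
  intro l hl n H v hH hHU
  obtain ⟨i, hi, hv⟩ := h (l.map Prod.swap) (fun p hp => by
    obtain ⟨q, hq, rfl⟩ := List.mem_map.1 hp
    obtain ⟨p, hp, rfl⟩ := hl q hq
    rwa [Prod.swap_swap]) n H v hH hHU
  refine ⟨i, ?_, hv⟩
  have := hi.swap
  rwa [← evalPairs_swap, List.map_map, Prod.swap_swap_eq, List.map_id] at this

lemma Consistent.sUnion {c : Set (Set ((lp (fun _ : K => X) ∞ × lp (fun _ : K => Z) ∞) ⊕ Ω))}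
    (hne : c.Nonempty) (hc : IsChain (· ⊆ ·) c)
    (h : ∀ s ∈ c, Consistent f (Sum.inl ⁻¹' s) (Sum.inr ⁻¹' s)) :
    Consistent f (Sum.inl ⁻¹' ⋃₀ c) (Sum.inr ⁻¹' ⋃₀ c) := by
  intro l hl n H v hH hHU
  obtain ⟨s, hs, hls⟩ : ∃ s ∈ c, Sum.inl '' {p | p ∈ l} ⊆ s := by
    refine hc.directedOn.exists_mem_subset_of_finite_of_subset_sUnion hne
      (l.finite_toSet.image _) ?_
    rintro _ ⟨p, hp, rfl⟩
    exact hl p hp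
  exact h s hs l (fun p hp => hls ⟨p, hp, rfl⟩) n H v hH
    (hHU.mono_right (Set.preimage_mono (Set.subset_sUnion_of_mem hs)))

lemma Consistent.exists_forth [Infinite N] (h : Consistent f P U) {dec : N → Z}
    (hdec : Function.Surjective dec) (hP : #P < #Ω) (hU : #U < #Ω) (hN : #N < #Ω)
    (a : lp (fun _ : K => X) ∞) :
    ∃ (b : lp (fun _ : K => Z) ∞) (U' : Set Ω), U ⊆ U' ∧ #U' ≤ max (max #P #U) #N ∧
      Consistent f (insert (a, b) P) U' := by
  classical
  obtain ⟨m, hm⟩ := exists_nat_ge ‖a‖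
  have hg : ∀ (q : List P × ℕ) (i : K), ∃ z : Z, ‖z‖ ≤ m + 1 ∧
      ((∃ z', BackForthAt q.2 (insert (a i, z') (evalPairs (q.1.map Subtype.val) i))) →
        BackForthAt q.2 (insert (a i, z) (evalPairs (q.1.map Subtype.val) i))) := fun q i => by
    by_cases hz : ∃ z', BackForthAt q.2 (insert (a i, z') (evalPairs (q.1.map Subtype.val) i))
    · obtain ⟨z, hz⟩ := hz
      refine ⟨z, ?_, fun _ => hz⟩
      have h1 := abs_le.1 (hz.zero_level.1 _ (Set.mem_insert _ _))
      have h2 : 1 / ((q.2 : ℝ) + 1) ≤ 1 := by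
        rw [div_le_one (by positivity)]
        linarith [(Nat.cast_nonneg q.2 : (0 : ℝ) ≤ q.2)]
      have h3 := lp_infty_norm_apply_le a i
      linarith [h1.1]
    · exact ⟨0, by simp; positivity, fun hz' => absurd hz' hz⟩
  choose g hgm hg using hg
  choose V hVcard hV using fun q : List P × ℕ =>
    exists_agree_of_independent f {i | BackForthAt (q.2 + 1) (evalPairs (q.1.map Subtype.val) i)} U
      (h _ (by simp +contextual) _) fun i => Function.surjInv hdec (g q i)
  have hN0 := aleph0_le_mk N
  have hQ : #(List P × ℕ) ≤ max (max #P #U) #N := by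
    have h1 : ℵ₀ ≤ max (max #P #U) #N := hN0.trans (le_max_right _ _)
    have h2 : #(List P) ≤ max (max #P #U) #N :=
      (mk_list_le_max P).trans (max_le h1 ((le_max_left _ _).trans (le_max_left _ _)))
    rw [mk_prod, lift_uzero, mk_nat, lift_aleph0]
    exact (mul_le_mul' h2 h1).trans (mul_eq_self h1).le
  have hU₁ : #(U ∪ ⋃ q, V q : Set Ω) ≤ max (max #P #U) #N := by
    have h1 : ℵ₀ ≤ max (max #P #U) #N := hN0.trans (le_max_right _ _)
    refine (mk_union_le _ _).trans (add_le_of_le h1 ((le_max_right _ _).trans (le_max_left _ _)) ?_)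
    refine (mk_iUnion_le _).trans ?_
    exact (mul_le_mul' hQ (ciSup_le' fun q => (hVcard q).trans (le_max_right _ _))).trans
      (mul_eq_self h1).le
  have hlt : max (max #P #U) #N < #Ω := max_lt (max_lt hP hU) hN
  obtain ⟨A, hA⟩ : ∃ A, A ∉ U ∪ ⋃ q, V q := by
    by_contra! hall
    rw [Set.eq_univ_of_forall hall, mk_univ] at hU₁
    exact hU₁.not_gt hlt
  have hAU : A ∉ U := fun hA' => hA (Or.inl hA')
  have hAV : ∀ q, A ∉ V q := fun q hA' => hA (Or.inr (Set.mem_iUnion.2 ⟨q, hA'⟩))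
  have hb : ∀ i, ‖if ‖dec (f A i)‖ ≤ m + 1 then dec (f A i) else 0‖ ≤ (m : ℝ) + 1 := fun i => by
    split_ifs with hi
    · exact hi
    · simp; positivity
  refine ⟨lpOfBound _ _ hb, insert A (U ∪ ⋃ q, V q),
    Set.subset_union_left.trans (Set.subset_insert _ _), ?_, fun l hl n H v hH hHU => ?_⟩
  · exact mk_insert_le.trans (add_le_of_le (hN0.trans (le_max_right _ _)) hU₁
      ((one_le_aleph0.trans hN0).trans (le_max_right _ _)))
  · obtain ⟨l', hl'⟩ : ∃ l' : List P, l ⊆ (a, lpOfBound _ _ hb) :: l'.map Subtype.val := by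
      refine ⟨(l.filter (· ∈ P)).attachWith (· ∈ P) (by simp), fun p hp => ?_⟩
      rcases hl p hp with rfl | hpP
      · simp
      · exact List.mem_cons_of_mem _ (by simpa using ⟨hp, hpP⟩)
    rw [Set.disjoint_insert_right, Set.disjoint_union_right] at hHU
    obtain ⟨i, hiE, hAi, hv⟩ := hV (l', max n m) A hAU (hAV _) H v hH hHU.2.1
      (hHU.2.2.mono_right (Set.subset_iUnion V _)) hHU.1
    refine ⟨i, BackForthAt.subset ?_ (evalPairs_mono hl' i), hv⟩
    rw [evalPairs_cons]
    have hbi : lpOfBound _ _ hb i = g (l', max n m) i := by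
      rw [lpOfBound_apply, hAi, Function.surjInv_eq hdec, if_pos (hgm _ i)]
    rw [hbi]
    refine (hg (l', max n m) i (BackForthAt.forth hiE ?_)).mono (le_max_left n m)
    exact (lp_infty_norm_apply_le a i).trans
      (hm.trans (by exact_mod_cast le_max_right n m))

end Consistent

section KeislerShelah

open Cardinal

variable {K : Type u} {X Z : Type u} [NormedAddCommGroup X] [NormedSpace ℝ X]
  [NormedAddCommGroup Z] [NormedSpace ℝ Z]

/-- A bi-total relation between bounded families whose finite subsets are almost everywhere good
positions of the back-and-forth game induces an isometric isomorphism of ultrapowers. -/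
lemma nonempty_linearIsometryEquiv {D : Ultrafilter K}
    {P : Set (lp (fun _ : K => X) ∞ × lp (fun _ : K => Z) ∞)}
    (hP : ∀ l : List (lp (fun _ : K => X) ∞ × lp (fun _ : K => Z) ∞), (∀ p ∈ l, p ∈ P) →
      ∀ n, ∀ᶠ i in D, BackForthAt n (evalPairs l i))
    (hX : ∀ a, ∃ b, (a, b) ∈ P) (hZ : ∀ b, ∃ a, (a, b) ∈ P) :
    Nonempty (Ultrapower K D X ≃ₗᵢ[ℝ] Ultrapower K D Z) := by
  have hdist : ∀ p ∈ P, ∀ q ∈ P,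
      dist (Submodule.Quotient.mk p.2 : Ultrapower K D Z) (Submodule.Quotient.mk q.2) =
        dist (Submodule.Quotient.mk p.1 : Ultrapower K D X) (Submodule.Quotient.mk q.1) := by
    intro p hp q hq
    have hlim := ((Ultrapower.tendsto_dist (D := D) p.1 q.1).sub
      (Ultrapower.tendsto_dist p.2 q.2)).abs
    refine (sub_eq_zero.1 <| abs_nonpos_iff.1 <|
      ge_of_tendsto' tendsto_one_div_add_atTop_nhds_zero_nat fun n => ?_).symm
    refine le_of_tendsto hlim ?_
    filter_upwards [hP [p, q] (by simp [hp, hq]) n] with i hi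
    exact hi.zero_level.2 _ ⟨p, by simp, rfl⟩ _ ⟨q, by simp, rfl⟩
  choose β hβ using hX
  let T : Ultrapower K D X → Ultrapower K D Z := fun x =>
    Submodule.Quotient.mk (β (Function.surjInv (Submodule.Quotient.mk_surjective _) x))
  have hT : Isometry T := Isometry.of_dist_eq fun x y => by
    refine (hdist _ (hβ _) _ (hβ _)).trans ?_
    simp only [Function.surjInv_eq]
  have hsurj : Function.Surjective T := fun z => by
    obtain ⟨b, rfl⟩ := Submodule.Quotient.mk_surjective _ z
    obtain ⟨a, hab⟩ := hZ b
    refine ⟨Submodule.Quotient.mk a, dist_eq_zero.1 ?_⟩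
    refine (hdist _ (hβ _) _ hab).trans ?_
    simp only [Function.surjInv_eq, dist_self]
  exact ⟨(IsometryEquiv.mk (Equiv.ofBijective T ⟨hT.injective, hsurj⟩) hT).toRealLinearIsometryEquiv⟩

/-- If the empty position is good for the back-and-forth game between `X` and `Z`, then `X` and
`Z` have isometric ultrapowers. -/
lemma ElemEquiv.of_backForthAt_empty (h : ∀ n, BackForthAt n (∅ : Set (X × Z))) :
    ElemEquiv X Z := by
  let N : Type u := X ⊕ Z ⊕ ULift.{u} ℕ
  let K := EKIndex N
  let Ω := Set (Set N)
  let : Inhabited N := ⟨Sum.inl 0⟩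
  have hN := aleph0_le_mk N
  have hNΩ : #N < #Ω := (cantor _).trans_le (by simpa [Ω] using (cantor _).le)
  let f : Ω → K → N := ekFun
  let decX : N → X := Function.invFun Sum.inl
  have hdecX : Function.Surjective decX := Function.invFun_surjective Sum.inl_injective
  let decZ : N → Z := Function.invFun (Sum.inr ∘ Sum.inl)
  have hdecZ : Function.Surjective decZ :=
    Function.invFun_surjective (Sum.inr_injective.comp Sum.inl_injective)
  let LX := lp (fun _ : K => X) ∞
  let LZ := lp (fun _ : K => Z) ∞
  let Meets : LX ⊕ LZ → Set ((LX × LZ) ⊕ Ω) → Prop := fun w s =>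
    Sum.elim (fun a => ∃ b, Sum.inl (a, b) ∈ s) (fun b => ∃ a, Sum.inl (a, b) ∈ s) w
  have hcard : ∀ s : Set ((LX × LZ) ⊕ Ω), #(Sum.inl ⁻¹' s : Set (LX × LZ)) ≤ #s ∧
      #(Sum.inr ⁻¹' s : Set Ω) ≤ #s := fun s =>
    ⟨mk_preimage_of_injective _ _ Sum.inl_injective, mk_preimage_of_injective _ _ Sum.inr_injective⟩
  have hstep : ∀ (s : Set ((LX × LZ) ⊕ Ω)) (p : LX × LZ) (U : Set Ω), Sum.inr ⁻¹' s ⊆ U →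
      #U ≤ max (max #(Sum.inl ⁻¹' s : Set (LX × LZ)) #(Sum.inr ⁻¹' s : Set Ω)) #N →
      Consistent f (insert p (Sum.inl ⁻¹' s)) U →
      ∃ t, s ⊆ t ∧ Consistent f (Sum.inl ⁻¹' t) (Sum.inr ⁻¹' t) ∧ Sum.inl p ∈ t ∧
        #t ≤ max #s #N := by
    intro s p U hsU hU hcon
    have hU' : #U ≤ max #s #N := hU.trans (max_le_max_right _ (max_le (hcard s).1 (hcard s).2))
    refine ⟨insert (Sum.inl p) (s ∪ Sum.inr '' U), ?_, ?_, Set.mem_insert _ _, ?_⟩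
    · exact Set.subset_union_left.trans (Set.subset_insert _ _)
    · convert hcon using 1
      · ext; simp
      · ext A
        simpa using fun hA => hsU hA
    · have h1 : ℵ₀ ≤ max #s #N := hN.trans (le_max_right _ _)
      refine mk_insert_le.trans (add_le_of_le h1 ?_ (one_le_aleph0.trans h1))
      exact (mk_union_le _ _).trans (add_le_of_le h1 (le_max_left _ _) (mk_image_le.trans hU'))
  obtain ⟨s, hs, hmeets⟩ := exists_forall_meets (μ := #N) (κ := #Ω) (Meets := Meets)
    (Con := fun s => Consistent f (Sum.inl ⁻¹' s) (Sum.inr ⁻¹' s)) hN hNΩ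
    (by
      rw [mk_sum, lift_id, lift_id]
      refine add_le_of_le (hN.trans hNΩ.le) (mk_lp_ekIndex_le ?_) (mk_lp_ekIndex_le ?_)
      · exact mk_le_of_surjective hdecX
      · exact mk_le_of_surjective hdecZ)
    (by
      intro l hl n H v hH _
      obtain ⟨i, hi⟩ := ekFun_independent H v hH
      exact ⟨i, (h n).subset (by rintro _ ⟨p, hp, rfl⟩; exact hl p hp), hi⟩)
    (by
      rintro (a | b) s t hst ⟨c, hc⟩
      · exact ⟨c, hst hc⟩
      · exact ⟨c, hst hc⟩)
    (fun c hne hc hcon => Consistent.sUnion hne hc hcon)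
    (by
      intro s hs hsΩ w
      have hP := (hcard s).1.trans_lt hsΩ
      have hU := (hcard s).2.trans_lt hsΩ
      rcases w with a | b
      · obtain ⟨b, U, h1, h2, h3⟩ := hs.exists_forth hdecZ hP hU hNΩ a
        obtain ⟨t, h4, h5, h6, h7⟩ := hstep s (a, b) U h1 h2 h3
        exact ⟨t, h4, h5, ⟨b, h6⟩, h7⟩
      · have hswap := mk_image_eq (s := (Sum.inl ⁻¹' s : Set (LX × LZ))) Prod.swap_injective
        obtain ⟨a, U, h1, h2, h3⟩ := hs.swap.exists_forth hdecX (hswap.trans_lt hP) hU hNΩ b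
        rw [hswap] at h2
        have h3' := h3.swap
        rw [Set.image_insert_eq, Set.image_image] at h3'
        simp only [Prod.swap_swap, Set.image_id', Prod.swap_prod_mk] at h3'
        obtain ⟨t, h4, h5, h6, h7⟩ := hstep s (a, b) U h1 h2 h3'
        exact ⟨t, h4, h5, ⟨a, h6⟩, h7⟩)
  let P : Set (LX × LZ) := Sum.inl ⁻¹' s
  let E : List P × ℕ → Set K := fun q => {i | BackForthAt q.2 (evalPairs (q.1.map Subtype.val) i)}
  have hE : ∀ q, (E q).Nonempty := fun q => by
    obtain ⟨i, hi, -⟩ := hs (q.1.map Subtype.val) (fun p hp => by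
      obtain ⟨p, -, rfl⟩ := List.mem_map.1 hp
      exact p.2) q.2 ∅
      (fun _ => default) (by simp) (by simp)
    exact ⟨i, hi⟩
  have : Nonempty K := ⟨(hE ([], 0)).some⟩
  have hne : (⨅ q, 𝓟 (E q)).NeBot := by
    refine iInf_neBot_of_directed (fun q r => ?_) fun q => principal_neBot_iff.2 (hE q)
    refine ⟨(q.1 ++ r.1, max q.2 r.2), principal_mono.2 fun i hi => ?_,
      principal_mono.2 fun i hi => ?_⟩
    · exact (BackForthAt.mono hi (le_max_left _ _)).subset (evalPairs_mono (by simp) i)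
    · exact (BackForthAt.mono hi (le_max_right _ _)).subset (evalPairs_mono (by simp) i)
  refine ⟨K, Ultrafilter.of (⨅ q, 𝓟 (E q)), nonempty_linearIsometryEquiv (P := P)
    (fun l hl n => ?_) (fun a => hmeets (Sum.inl a)) fun b => hmeets (Sum.inr b)⟩
  have hmem : E (l.attachWith (· ∈ P) hl, n) ∈ ⨅ q, 𝓟 (E q) :=
    mem_iInf_of_mem _ (mem_principal_self _)
  filter_upwards [Ultrafilter.of_le _ hmem] with i hi
  have hi' : BackForthAt n (evalPairs ((l.attachWith (· ∈ P) hl).map Subtype.val) i) := hi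
  rwa [List.attachWith_map_subtype_val] at hi'

end KeislerShelah

/-- Elementary equivalence of Banach spaces is an equivalence relation;
in particular it is transitive. -/
theorem elemEquiv_equivalence :
    Equivalence (fun X Y : BanachSpace.{u} => ElemEquiv X.carrier Y.carrier) := by
  refine ⟨fun X => ⟨PUnit, pure PUnit.unit, ⟨LinearIsometryEquiv.refl ℝ _⟩⟩, ?_, ?_⟩
  · rintro X Y ⟨K, G, ⟨T⟩⟩
    exact ⟨K, G, ⟨T.symm⟩⟩
  · intro X Y Z hXY hYZ
    exact ElemEquiv.of_backForthAt_empty (hXY.backForthAt_trans hYZ)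
end
end
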